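/- arXiv:2312.06846 — 2 statements merged into one kernel-verified Lean document; each statement's English description precedes it below -/
import Mathlib

section
/- Let (R,m) be a Cohen-Macaulay Noetherian local ring of dimension d > 0 and let I be an m-primary ideal with I ⊆ m². Then ν(I) ≤ e_0(I) ≤ d!·λ(R/Ī)·e_0(R), where ν(I) is the minimal number of generators of I, Ī is the integral closure of I, and e_0(R) is the multiplicity of R with respect to m. -/
open Finset IsLocalRing

/-- The length of an `R`-module `M`: the Krull dimension of its lattice of submodules,
i.e. the supremum of the lengths of chains of submodules of `M`. -/
noncomputable def moduleLength (R M : Type*) [CommRing R] [AddCommGroup M] [Module R M] :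
    WithBot ℕ∞ :=
  Order.krullDim (Submodule R M)

/-- A local Noetherian ring is Cohen-Macaulay if its depth equals its Krull dimension,
equivalently, if it admits a regular sequence in the maximal ideal whose length is the
Krull dimension. -/
def IsCohenMacaulayLocalRing (R : Type*) [CommRing R] [IsLocalRing R] : Prop :=
  ∃ rs : List R, (∀ x ∈ rs, x ∈ maximalIdeal R) ∧
    RingTheory.Sequence.IsRegular R rs ∧ (rs.length : WithBot ℕ∞) = ringKrullDim R

/-- `e 0, …, e d` are the Hilbert coefficients of an ideal `I` in a ring of dimension `d`:
for all large `n`, `λ(R ⧸ I^(n+1)) = ∑_{i=0}^{d} (-1)^i (e i) C(n+d-i, d-i)`. -/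
def HasHilbertCoeffs {R : Type*} [CommRing R] (I : Ideal R) (d : ℕ) (e : ℕ → ℤ) : Prop :=
  ∃ N : ℕ, ∀ n ≥ N, ∃ l : ℕ,
    moduleLength R (R ⧸ I ^ (n + 1)) = (l : WithBot ℕ∞) ∧
    (l : ℤ) = ∑ i ∈ Finset.range (d + 1), (-1 : ℤ) ^ i * e i * ((n + d - i).choose (d - i))

/-- The set of elements integral over an ideal `I`: all `y` satisfying an equation
`y^m + a₁ y^(m-1) + ⋯ + a_m = 0` with `a_j ∈ I^j`. -/
def integralOverIdeal {R : Type*} [CommRing R] (I : Ideal R) : Set R :=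
  {y | ∃ m : ℕ, 0 < m ∧ ∃ a : ℕ → R, (∀ j, 1 ≤ j → j ≤ m → a j ∈ I ^ j) ∧
    y ^ m + ∑ j ∈ Finset.Icc 1 m, a j * y ^ (m - j) = 0}

/-- The integral closure of an ideal `I`, as an ideal (the set of elements integral over
`I` is an ideal, so it coincides with the ideal it generates). -/
noncomputable def idealIntegralClosure {R : Type*} [CommRing R] (I : Ideal R) : Ideal R :=
  Ideal.span (integralOverIdeal I)

section Length

variable {R : Type*} [CommRing R]

lemma length_quotient_anti {A B : Ideal R} (h : A ≤ B) :
    Module.length R (R ⧸ B) ≤ Module.length R (R ⧸ A) :=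
  Module.length_le_of_surjective (Submodule.factor h) (Submodule.factor_surjective h)

/-- `B` is the colon ideal `A : x`. -/
lemma length_quotient_eq_add {A B : Ideal R} {x : R} (h : ∀ a, a ∈ B ↔ x * a ∈ A) :
    Module.length R (R ⧸ A) =
      Module.length R (R ⧸ B) + Module.length R (R ⧸ (A ⊔ Ideal.span {x})) := by
  let f : (R ⧸ B) →ₗ[R] (R ⧸ A) :=
    Submodule.mapQ B A (LinearMap.mulLeft R x) fun a ha => (h a).1 ha
  let g : (R ⧸ A) →ₗ[R] (R ⧸ (A ⊔ Ideal.span {x})) := Submodule.factor le_sup_left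
  refine Module.length_eq_add_of_exact f g ?_ (Submodule.factor_surjective _) ?_
  · rw [injective_iff_map_eq_zero]
    intro a ha
    obtain ⟨a, rfl⟩ := Submodule.Quotient.mk_surjective _ a
    have : Submodule.Quotient.mk (p := A) (x * a) = 0 := ha
    rw [Submodule.Quotient.mk_eq_zero] at this ⊢
    exact (h a).2 this
  · intro b
    obtain ⟨b, rfl⟩ := Submodule.Quotient.mk_surjective _ b
    have hg : g (Submodule.Quotient.mk b) = Submodule.Quotient.mk b := rfl
    rw [hg, Submodule.Quotient.mk_eq_zero]
    constructor
    · intro hb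
      obtain ⟨a, ha, c, hc, rfl⟩ := Submodule.mem_sup.1 hb
      obtain ⟨c, rfl⟩ := Ideal.mem_span_singleton'.1 hc
      refine ⟨Submodule.Quotient.mk c, ?_⟩
      change Submodule.Quotient.mk (x * c) = _
      rw [Submodule.Quotient.eq]
      have : x * c - (a + c * x) = -a := by ring
      rw [this]
      exact neg_mem ha
    · rintro ⟨c, hc⟩
      obtain ⟨c, rfl⟩ := Submodule.Quotient.mk_surjective _ c
      change Submodule.Quotient.mk (x * c) = _ at hc
      rw [Submodule.Quotient.eq] at hc
      have : b = -(x * c - b) + c * x := by ring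
      rw [this]
      exact add_mem (Ideal.mem_sup_left (neg_mem hc))
        (Ideal.mem_sup_right (Ideal.mem_span_singleton'.2 ⟨c, rfl⟩))

variable [IsLocalRing R]

lemma length_quotient_maximalIdeal : Module.length R (R ⧸ maximalIdeal R) = 1 := by
  rw [Module.length_eq_one_iff, isSimpleModule_iff_isCoatom]
  exact (maximalIdeal.isMaximal R).out

lemma length_quotient_eq_add_one {A : Ideal R} {u : R} (hu : u ∉ A)
    (hmu : ∀ a ∈ maximalIdeal R, u * a ∈ A) :
    Module.length R (R ⧸ A) = Module.length R (R ⧸ (A ⊔ Ideal.span {u})) + 1 := by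
  rw [length_quotient_eq_add (x := u) (B := maximalIdeal R), length_quotient_maximalIdeal,
    add_comm]
  refine fun a => ⟨hmu a, fun ha => ?_⟩
  by_contra hna
  have hunit : IsUnit a := by simpa using hna
  exact hu ((Ideal.unit_mul_mem_iff_mem A hunit).1 (by rwa [mul_comm] at ha))

lemma length_quotient_le_add_one {A : Ideal R} {u : R}
    (hmu : ∀ a ∈ maximalIdeal R, u * a ∈ A) :
    Module.length R (R ⧸ A) ≤ Module.length R (R ⧸ (A ⊔ Ideal.span {u})) + 1 := by
  by_cases hu : u ∈ A
  · rw [sup_eq_left.2 ((Ideal.span_singleton_le_iff_mem A).2 hu)]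
    exact le_self_add
  · exact (length_quotient_eq_add_one hu hmu).le

/-- A form of `ν(A) = λ(R/𝔪A) - λ(R/A)`. -/
lemma exists_generators_card_add_length_le [IsNoetherianRing R] (A : Ideal R) :
    ∃ s : Finset R, Ideal.span (s : Set R) = A ∧
      (s.card : ℕ∞) + Module.length R (R ⧸ A) ≤
        Module.length R (R ⧸ (maximalIdeal R * A)) := by
  classical
  have key : ∀ B : Ideal R, maximalIdeal R * A ≤ B → B ≤ A → ∃ s : Finset R,
      B ⊔ Ideal.span (s : Set R) = A ∧
      (s.card : ℕ∞) + Module.length R (R ⧸ A) ≤ Module.length R (R ⧸ B) := by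
    intro B
    induction B using IsNoetherian.induction with
    | _ B ih =>
    intro hB hBA
    by_cases hAB : A ≤ B
    · obtain rfl := le_antisymm hAB hBA
      exact ⟨∅, by simp, by simp⟩
    · obtain ⟨u, huA, huB⟩ := SetLike.not_le_iff_exists.1 hAB
      obtain ⟨s, hs, hcard⟩ := ih (B ⊔ Ideal.span {u})
        (left_lt_sup.2 fun h => huB ((Ideal.span_singleton_le_iff_mem B).1 h))
        (hB.trans le_sup_left) (sup_le hBA ((Ideal.span_singleton_le_iff_mem A).2 huA))
      refine ⟨insert u s, ?_, ?_⟩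
      · rw [← hs, Finset.coe_insert, Ideal.span_insert, sup_assoc]
      · rw [length_quotient_eq_add_one huB fun a ha => hB (by
          rw [mul_comm u a]; exact Ideal.mul_mem_mul ha huA)]
        refine le_trans ?_ (add_le_add_left hcard 1)
        rw [add_right_comm]
        gcongr
        exact_mod_cast Finset.card_insert_le u s
  obtain ⟨s, hs, hcard⟩ := key _ le_rfl Ideal.mul_le_right
  refine ⟨s, le_antisymm (hs ▸ le_sup_right) ?_, hcard⟩
  refine Submodule.le_of_le_smul_of_le_jacobson_bot (I := maximalIdeal R)
    (IsNoetherian.noetherian A) (IsLocalRing.maximalIdeal_le_jacobson _) ?_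
  rw [smul_eq_mul, sup_comm, hs]

end Length

section Monomials

variable {N : ℕ}

/-- The degree-lexicographic key of an exponent vector. -/
def degLexKey (μ : Fin N → ℕ) : ℕ ×ₗ Lex (Fin N → ℕ) :=
  toLex (∑ i, μ i, toLex μ)

lemma degLexKey_injective : Function.Injective (degLexKey (N := N)) := by
  intro μ ν h
  exact congrArg (fun p => ofLex (ofLex p).2) h

lemma degLexKey_lt_of_sum_lt {μ ν : Fin N → ℕ} (h : ∑ i, μ i < ∑ i, ν i) :
    degLexKey μ < degLexKey ν :=
  Prod.Lex.toLex_lt_toLex.2 (Or.inl h)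

lemma degLexKey_add_lt_add {μ ν : Fin N → ℕ} (h : degLexKey μ < degLexKey ν)
    (ρ : Fin N → ℕ) : degLexKey (μ + ρ) < degLexKey (ν + ρ) := by
  rw [degLexKey, degLexKey, Prod.Lex.toLex_lt_toLex] at h ⊢
  simp only [Pi.add_apply, Finset.sum_add_distrib]
  rcases h with h | ⟨h1, h2⟩
  · exact Or.inl (by simpa using h)
  · refine Or.inr ⟨by simpa using h1, ?_⟩
    simp only at h2 ⊢
    rw [toLex_add, toLex_add]
    exact add_lt_add_left h2 _

variable {R : Type*} [CommRing R] (y : Fin N → R)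

def monomialValue (μ : Fin N → ℕ) : R := ∏ i, y i ^ μ i

lemma monomialValue_add (μ ν : Fin N → ℕ) :
    monomialValue y (μ + ν) = monomialValue y μ * monomialValue y ν := by
  simp [monomialValue, pow_add, Finset.prod_mul_distrib]

lemma monomialValue_zero : monomialValue y 0 = 1 := by simp [monomialValue]

lemma monomialValue_single (i : Fin N) : monomialValue y (Pi.single i 1) = y i := by
  rw [monomialValue, Finset.prod_eq_single i] <;> simp +contextual

lemma monomialValue_mem_pow (μ : Fin N → ℕ) :
    monomialValue y μ ∈ Ideal.span (Set.range y) ^ (∑ i, μ i) := by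
  rw [← Finset.prod_pow_eq_pow_sum]
  exact Ideal.prod_mem_prod fun i _ => Ideal.pow_mem_pow (Ideal.subset_span (Set.mem_range_self i)) _

lemma pow_span_le_span_monomialValue (n : ℕ) :
    Ideal.span (Set.range y) ^ n ≤
      Ideal.span (monomialValue y '' {μ | ∑ i, μ i = n}) := by
  induction n with
  | zero =>
    have : (1 : R) ∈ Ideal.span (monomialValue y '' {μ | ∑ i, μ i = 0}) :=
      Ideal.subset_span ⟨0, by simp, monomialValue_zero y⟩
    rw [(Ideal.eq_top_iff_one _).2 this]
    exact le_top
  | succ n ih =>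
    rw [pow_succ]
    refine (Ideal.mul_mono_left ih).trans ?_
    rw [Ideal.span_mul_span', Ideal.span_le]
    rintro _ ⟨_, ⟨μ, hμ, rfl⟩, _, ⟨i, rfl⟩, rfl⟩
    refine Ideal.subset_span ⟨μ + Pi.single i 1, ?_, ?_⟩
    · simp only [Set.mem_ofPred_eq] at hμ
      simp [Finset.sum_add_distrib, hμ]
    · simp [monomialValue_add, monomialValue_single]

/-- The ideal generated by the monomials strictly above `μ`. -/
def monomialsAbove (μ : Fin N → ℕ) : Ideal R :=
  Ideal.span (monomialValue y '' {ν | degLexKey μ < degLexKey ν})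

lemma monomialValue_mem_monomialsAbove {μ ν : Fin N → ℕ} (h : degLexKey μ < degLexKey ν) :
    monomialValue y ν ∈ monomialsAbove y μ :=
  Ideal.subset_span ⟨ν, h, rfl⟩

lemma pow_span_le_monomialsAbove {μ : Fin N → ℕ} {n : ℕ} (h : ∑ i, μ i < n) :
    Ideal.span (Set.range y) ^ n ≤ monomialsAbove y μ := by
  refine (pow_span_le_span_monomialValue y n).trans (Ideal.span_mono (Set.image_mono ?_))
  rintro ν rfl
  exact degLexKey_lt_of_sum_lt h

lemma monomialValue_mul_mem_monomialsAbove {μ : Fin N → ℕ} (ν : Fin N → ℕ) {f : R}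
    (hf : f ∈ monomialsAbove y μ) :
    monomialValue y ν * f ∈ monomialsAbove y (μ + ν) := by
  have : monomialsAbove y μ ≤
      Submodule.comap (LinearMap.mulLeft R (monomialValue y ν)) (monomialsAbove y (μ + ν)) := by
    refine Ideal.span_le.2 ?_
    rintro _ ⟨ρ, hρ, rfl⟩
    change monomialValue y ν * monomialValue y ρ ∈ monomialsAbove y (μ + ν)
    rw [mul_comm, ← monomialValue_add]
    exact monomialValue_mem_monomialsAbove y (degLexKey_add_lt_add hρ ν)
  exact this hf

lemma mul_mem_monomialsAbove {μ ν : Fin N → ℕ} {f g : R}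
    (hf : f ∈ monomialsAbove y μ) (hg : g ∈ monomialsAbove y ν) :
    f * g ∈ monomialsAbove y (μ + ν) := by
  have : monomialsAbove y μ ≤
      Submodule.comap (LinearMap.mulLeft R g) (monomialsAbove y (μ + ν)) := by
    refine Ideal.span_le.2 ?_
    rintro _ ⟨ρ, hρ, rfl⟩
    change g * monomialValue y ρ ∈ monomialsAbove y (μ + ν)
    rw [mul_comm]
    have h := monomialValue_mul_mem_monomialsAbove y ρ hg
    refine Ideal.span_mono (Set.image_mono fun τ hτ => ?_) h
    rw [Set.mem_ofPred_eq] at hτ ⊢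
    refine lt_trans ?_ hτ
    rw [add_comm ν ρ]
    exact degLexKey_add_lt_add hρ ν
  rw [mul_comm]
  exact this hf

/-- The exponents of the initial forms of elements of `K`. -/
def initialExponents (K : Ideal R) : Set (Fin N → ℕ) :=
  {μ | monomialValue y μ ∈ K ⊔ monomialsAbove y μ}

lemma initialExponents_mono {K L : Ideal R} (h : K ≤ L) :
    initialExponents y K ⊆ initialExponents y L :=
  fun _ hμ => sup_le_sup_right h _ hμ

lemma add_mem_initialExponents_mul {K L : Ideal R} {μ ν : Fin N → ℕ}
    (hμ : μ ∈ initialExponents y K) (hν : ν ∈ initialExponents y L) :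
    μ + ν ∈ initialExponents y (K * L) := by
  obtain ⟨k, hk, f, hf, h1⟩ := Submodule.mem_sup.1 hμ
  obtain ⟨l, hl, g, hg, h2⟩ := Submodule.mem_sup.1 hν
  refine Submodule.mem_sup.2 ⟨k * l, Ideal.mul_mem_mul hk hl,
    monomialValue y ν * f + monomialValue y μ * g - f * g, ?_, ?_⟩
  · refine sub_mem (add_mem (monomialValue_mul_mem_monomialsAbove y ν hf) ?_)
      (mul_mem_monomialsAbove y hf hg)
    rw [add_comm μ]
    exact monomialValue_mul_mem_monomialsAbove y μ hg
  · rw [monomialValue_add, ← h1, ← h2]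
    ring

lemma add_mem_initialExponents {K : Ideal R} {μ : Fin N → ℕ}
    (hμ : μ ∈ initialExponents y K) (ν : Fin N → ℕ) : μ + ν ∈ initialExponents y K := by
  have : ν ∈ initialExponents y (⊤ : Ideal R) := by simp [initialExponents]
  simpa using add_mem_initialExponents_mul y hμ this

lemma nsmul_mem_initialExponents {K : Ideal R} {μ : Fin N → ℕ}
    (hμ : μ ∈ initialExponents y K) (n : ℕ) : n • μ ∈ initialExponents y (K ^ n) := by
  induction n with
  | zero => simp [initialExponents]
  | succ n ih =>
    rw [succ_nsmul, pow_succ]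
    exact add_mem_initialExponents_mul y ih hμ

lemma finite_setOf_sum_lt (c : ℕ) : {μ : Fin N → ℕ | ∑ i, μ i < c}.Finite := by
  refine (Set.finite_Iic (fun _ : Fin N => c)).subset fun μ hμ i => ?_
  exact (Finset.single_le_sum (fun _ _ => Nat.zero_le _) (Finset.mem_univ i)).trans
    (le_of_lt hμ)

variable [IsLocalRing R] {y}

open Classical in
lemma length_quotient_sup_span_monomialValue (hy : Ideal.span (Set.range y) = maximalIdeal R)
    (K : Ideal R) (s : Finset (Fin N → ℕ)) :
    (∀ μ ∈ s, ∀ ν, degLexKey ν < degLexKey μ → ν ∈ s) →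
      Module.length R (R ⧸ (K ⊔ Ideal.span (monomialValue y '' {ν | ν ∉ s}))) =
        #{μ ∈ s | μ ∉ initialExponents y K} := by
  induction s using Finset.induction_on_max_value (f := degLexKey) with
  | empty =>
    intro _
    have : Ideal.span (monomialValue y '' {ν | ν ∉ (∅ : Finset (Fin N → ℕ))}) = ⊤ :=
      (Ideal.eq_top_iff_one _).2 (Ideal.subset_span ⟨0, by simp, monomialValue_zero y⟩)
    rw [this, sup_top_eq]
    simp only [Finset.filter_empty, Finset.card_empty, Nat.cast_zero]
    exact Module.length_eq_zero
  | insert a s ha hmax ih =>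
    intro hs
    specialize ih fun μ hμ ν hν => by
      have := hs μ (Finset.mem_insert_of_mem hμ) ν hν
      rcases Finset.mem_insert.1 this with rfl | h
      · exact absurd (hmax μ hμ) (not_le.2 hν)
      · exact h
    have habove : {ν | ν ∉ insert a s} = {ν | degLexKey a < degLexKey ν} := by
      ext ν
      simp only [Set.mem_ofPred_eq]
      constructor
      · intro h
        by_contra hlt
        rcases (not_lt.1 hlt).eq_or_lt with h' | h'
        · exact h (by rw [degLexKey_injective h']; exact Finset.mem_insert_self _ _)
        · exact h (hs a (Finset.mem_insert_self _ _) ν h')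
      · intro h h'
        rcases Finset.mem_insert.1 h' with rfl | h'
        · exact lt_irrefl _ h
        · exact absurd (hmax ν h') (not_le.2 h)
    have hcompl : {ν | ν ∉ s} = insert a {ν | degLexKey a < degLexKey ν} := by
      rw [← habove]
      ext ν
      simp only [Set.mem_ofPred_eq, Set.mem_insert_iff, Finset.mem_insert]
      by_cases h : ν = a
      · simp [h, ha]
      · simp [h]
    rw [habove]
    rw [hcompl, Set.image_insert_eq, Ideal.span_insert, sup_comm (Ideal.span {_}), ← sup_assoc]
      at ih
    change Module.length R (R ⧸ (K ⊔ monomialsAbove y a ⊔ _)) = _ at ih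
    change Module.length R (R ⧸ (K ⊔ monomialsAbove y a)) = _
    rw [Finset.filter_insert]
    by_cases hK : a ∈ initialExponents y K
    · rw [if_neg (not_not.2 hK), ← ih,
        sup_eq_left.2 ((Ideal.span_singleton_le_iff_mem (K ⊔ monomialsAbove y a)).2 hK)]
    · rw [if_pos hK, Finset.card_insert_of_notMem (by simp [ha]), Nat.cast_add, ← ih, Nat.cast_one]
      refine length_quotient_eq_add_one hK fun b hb => Ideal.mem_sup_right ?_
      rw [← hy] at hb
      have : Ideal.span (Set.range y) ≤
          Submodule.comap (LinearMap.mulLeft R (monomialValue y a)) (monomialsAbove y a) := by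
        refine Ideal.span_le.2 ?_
        rintro _ ⟨i, rfl⟩
        change monomialValue y a * y i ∈ monomialsAbove y a
        rw [← monomialValue_single y i, ← monomialValue_add]
        refine monomialValue_mem_monomialsAbove y (degLexKey_lt_of_sum_lt ?_)
        simp [Finset.sum_add_distrib]
      exact this hb

lemma length_quotient_eq_encard (hy : Ideal.span (Set.range y) = maximalIdeal R)
    {K : Ideal R} {c : ℕ} (hc : maximalIdeal R ^ c ≤ K) :
    Module.length R (R ⧸ K) = (initialExponents y K)ᶜ.encard := by
  classical
  have h := length_quotient_sup_span_monomialValue hy K (finite_setOf_sum_lt c).toFinset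
    (fun μ hμ ν hν => by
      simp only [Set.Finite.mem_toFinset, Set.mem_ofPred_eq] at hμ ⊢
      refine lt_of_le_of_lt ?_ hμ
      by_contra hlt
      exact lt_asymm hν (degLexKey_lt_of_sum_lt (not_le.1 hlt)))
  have hmem : ∀ ν : Fin N → ℕ, c ≤ ∑ i, ν i → monomialValue y ν ∈ K := fun ν hν =>
    hc (Ideal.pow_le_pow_right hν (hy ▸ monomialValue_mem_pow y ν))
  rw [sup_eq_left.2] at h
  · rw [h, ← Set.encard_coe_eq_coe_finsetCard]
    congr 1
    ext ν
    simp only [Finset.coe_filter, Set.Finite.mem_toFinset, Set.mem_ofPred_eq, Set.mem_compl_iff,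
      and_iff_right_iff_imp]
    intro hν
    by_contra hlt
    exact hν (Ideal.mem_sup_left (hmem ν (not_lt.1 hlt)))
  · refine Ideal.span_le.2 ?_
    rintro _ ⟨ν, hν, rfl⟩
    exact hmem ν (by simpa using hν)

/-- The number of standard exponents in the box `[0, n)^N` controls `λ(R/Kⁿ) / λ(R/K)`. -/
lemma length_quotient_pow_le (hy : Ideal.span (Set.range y) = maximalIdeal R)
    {K : Ideal R} {c : ℕ} (hc : maximalIdeal R ^ c ≤ K) {n : ℕ} (hn : 0 < n) :
    Module.length R (R ⧸ K ^ n) ≤ Module.length R (R ⧸ K) *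
      ((initialExponents y ⊥)ᶜ ∩ {μ | ∀ i, μ i < n}).encard := by
  have hcn : maximalIdeal R ^ (c * n) ≤ K ^ n := by
    rw [pow_mul]
    exact Ideal.pow_right_mono hc n
  rw [length_quotient_eq_encard hy hc, length_quotient_eq_encard hy hcn, ← Set.encard_prod]
  refine Set.encard_le_encard_of_injOn
    (f := fun μ => ((fun i => μ i / n), (fun i => μ i % n))) ?_ ?_
  · intro μ hμ
    have hsplit : n • (fun i => μ i / n) + (fun i => μ i % n) = μ := by
      ext i
      simp [Nat.div_add_mod]
    refine ⟨fun hq => hμ ?_, fun hr => hμ ?_, fun i => Nat.mod_lt _ hn⟩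
    · rw [← hsplit]
      exact add_mem_initialExponents y (nsmul_mem_initialExponents y hq n) _
    · rw [← hsplit, add_comm]
      exact add_mem_initialExponents y (initialExponents_mono y bot_le hr) _
  · intro μ _ ν _ h
    simp only [Prod.mk.injEq] at h
    ext i
    rw [← Nat.div_add_mod (μ i) n, ← Nat.div_add_mod (ν i) n, congrFun h.1 i, congrFun h.2 i]

lemma encard_le_length_quotient_pow (hy : Ideal.span (Set.range y) = maximalIdeal R) (n : ℕ) :
    ((initialExponents y ⊥)ᶜ ∩ {μ | ∑ i, μ i ≤ n}).encard ≤
      Module.length R (R ⧸ maximalIdeal R ^ (n + 1)) := by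
  rw [length_quotient_eq_encard hy le_rfl]
  refine Set.encard_le_encard fun μ hμ hin => hμ.1 ?_
  have hle : maximalIdeal R ^ (n + 1) ≤ monomialsAbove y μ :=
    hy ▸ pow_span_le_monomialsAbove y (Nat.lt_succ_of_le hμ.2)
  exact Ideal.mem_sup_right (sup_eq_right.2 hle ▸ hin)

end Monomials

section Counting

/-- `B` is at most a sum of powers `n ^ f`, and `S` is at least the corresponding sum of shifted
simplex counts `C(n - b + f, f)`. -/
def IsStanleyBounded (B S : ℕ → ℕ) : Prop :=
  ∃ L : List (ℕ × ℕ), ∀ n, B n ≤ (L.map fun p => n ^ p.2).sum ∧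
    (L.map fun p => if p.1 ≤ n then (n - p.1 + p.2).choose p.2 else 0).sum ≤ S n

namespace IsStanleyBounded

variable {B S B' S' : ℕ → ℕ}

lemma mono (h : IsStanleyBounded B S) (hB : ∀ n, B' n ≤ B n) (hS : ∀ n, S n ≤ S' n) :
    IsStanleyBounded B' S' := by
  obtain ⟨L, hL⟩ := h
  exact ⟨L, fun n => ⟨(hB n).trans (hL n).1, (hL n).2.trans (hS n)⟩⟩

lemma zero : IsStanleyBounded (fun _ => 0) fun _ => 0 := ⟨[], by simp⟩

lemma one : IsStanleyBounded (fun _ => 1) fun _ => 1 := ⟨[(0, 0)], by simp⟩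

lemma add (h : IsStanleyBounded B S) (h' : IsStanleyBounded B' S') :
    IsStanleyBounded (fun n => B n + B' n) fun n => S n + S' n := by
  obtain ⟨L, hL⟩ := h
  obtain ⟨L', hL'⟩ := h'
  refine ⟨L ++ L', fun n => ?_⟩
  rw [List.map_append, List.map_append, List.sum_append, List.sum_append]
  exact ⟨add_le_add (hL n).1 (hL' n).1, add_le_add (hL n).2 (hL' n).2⟩

lemma sum {B S : ℕ → ℕ → ℕ} (h : ∀ j, IsStanleyBounded (B j) (S j)) (m : ℕ) :
    IsStanleyBounded (fun n => ∑ j ∈ range m, B j n) fun n => ∑ j ∈ range m, S j n := by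
  induction m with
  | zero => simpa using zero
  | succ m ih => simpa [Finset.sum_range_succ] using ih.add (h m)

lemma shift (h : IsStanleyBounded B S) (j : ℕ) :
    IsStanleyBounded B fun n => if j ≤ n then S (n - j) else 0 := by
  obtain ⟨L, hL⟩ := h
  refine ⟨L.map fun p => (p.1 + j, p.2), fun n => ⟨?_, ?_⟩⟩
  · simpa [Function.comp_def] using (hL n).1
  · rw [List.map_map]
    dsimp only
    split_ifs with hj
    · refine le_of_eq_of_le ?_ (hL (n - j)).2
      congr 1
      refine List.map_congr_left fun p _ => ?_
      have h1 : p.1 + j ≤ n ↔ p.1 ≤ n - j := by omega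
      have h2 : n - (p.1 + j) = n - j - p.1 := by omega
      simp [h1, h2]
    · refine le_of_eq (List.sum_eq_zero fun x hx => ?_)
      obtain ⟨p, _, rfl⟩ := List.mem_map.1 hx
      exact if_neg (by dsimp only; omega)

lemma sum_shifted_choose (b f n : ℕ) :
    ∑ k ∈ range (n + 1), (if b ≤ k then (k - b + f).choose f else 0) =
      if b ≤ n then (n - b + (f + 1)).choose (f + 1) else 0 := by
  induction n with
  | zero => by_cases hb : b = 0 <;> simp [hb]
  | succ n ih =>
    rw [Finset.sum_range_succ, ih]
    by_cases hb : b ≤ n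
    · have h : n + 1 - b + (f + 1) = (n - b + (f + 1)) + 1 := by omega
      have h' : n + 1 - b + f = n - b + (f + 1) := by omega
      rw [if_pos hb, if_pos (by omega), if_pos (by omega), h, Nat.choose_succ_succ, h', add_comm]
    · by_cases hb' : b = n + 1
      · simp [hb']
      · rw [if_neg hb, if_neg (by omega), if_neg (by omega)]

lemma cone (h : IsStanleyBounded B S) :
    IsStanleyBounded (fun n => n * B n) fun n => ∑ k ∈ range (n + 1), S k := by
  obtain ⟨L, hL⟩ := h
  refine ⟨L.map fun p => (p.1, p.2 + 1), fun n => ⟨?_, ?_⟩⟩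
  · refine (Nat.mul_le_mul_left n (hL n).1).trans (le_of_eq ?_)
    rw [List.map_map, ← List.sum_map_mul_left]
    simp [Function.comp_def, pow_succ']
  · refine le_trans (le_of_eq ?_) (Finset.sum_le_sum fun k _ => (hL k).2)
    rw [List.map_map]
    clear hL
    induction L with
    | nil => simp
    | cons p L ih =>
      simp only [List.map_cons, List.sum_cons, Finset.sum_add_distrib, ← ih, Function.comp_apply,
        sum_shifted_choose]

end IsStanleyBounded

variable {N : ℕ}

lemma finite_box (n : ℕ) : {μ : Fin N → ℕ | ∀ i, μ i < n}.Finite :=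
  (Set.finite_Iic (fun _ : Fin N => n)).subset fun _ hμ i => (hμ i).le

lemma ncard_eq_sum_slices {A : Set (Fin (N + 1) → ℕ)} (hA : A.Finite) {n : ℕ}
    (h : ∀ μ ∈ A, μ 0 < n) :
    A.ncard = ∑ j ∈ range n, {ν : Fin N → ℕ | Fin.cons j ν ∈ A}.ncard := by
  classical
  rw [Set.ncard_eq_toFinset_card A hA,
    Finset.card_eq_sum_card_fiberwise (f := fun μ => μ 0) (t := range n)
      (fun μ hμ => by simpa using h μ (by simpa using hμ))]
  refine Finset.sum_congr rfl fun j _ => ?_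
  rw [← Set.ncard_coe_finset,
    ← Set.ncard_image_of_injective {ν : Fin N → ℕ | Fin.cons j ν ∈ A}
      (Fin.cons_right_injective (α := fun _ => ℕ) j)]
  refine congrArg Set.ncard ?_
  ext μ
  simp only [Finset.coe_filter, Set.Finite.mem_toFinset, Set.mem_ofPred_eq, Set.mem_image]
  constructor
  · rintro ⟨hμ, rfl⟩
    exact ⟨Fin.tail μ, by simpa using hμ, by simp⟩
  · rintro ⟨ν, hν, rfl⟩
    exact ⟨hν, by simp⟩

lemma exists_forall_slice_subset {α : Type*} [PartialOrder α] [WellQuasiOrderedLE α]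
    {T : ℕ → Set α} (hT : ∀ j, IsLowerSet (T j)) (hanti : Antitone T) :
    ∃ j₀, ∀ j, T j₀ ⊆ T j := by
  have hfin : {μ | Minimal (fun μ => ∃ j, μ ∉ T j) μ}.Finite :=
    WellQuasiOrderedLE.finite_of_isAntichain (setOfPred_minimal_antichain _)
  have hex : ∀ μ, ∃ j, (∃ i, μ ∉ T i) → μ ∉ T j := fun μ => by
    by_cases h : ∃ i, μ ∉ T i
    · obtain ⟨i, hi⟩ := h
      exact ⟨i, fun _ => hi⟩
    · exact ⟨0, fun h' => absurd h' h⟩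
  choose g hg using hex
  refine ⟨hfin.toFinset.sup g, fun j ν hν => ?_⟩
  by_contra hνj
  obtain ⟨μ, hμν, hμ⟩ := exists_minimal_le_of_wellFoundedLT (fun μ => ∃ j, μ ∉ T j) ν ⟨j, hνj⟩
  exact hg μ hμ.prop (hanti (Finset.le_sup (hfin.mem_toFinset.2 hμ)) (hT _ hμν hν))

lemma isStanleyBounded_of_isLowerSet {N : ℕ} {T : Set (Fin N → ℕ)} (hT : IsLowerSet T) :
    IsStanleyBounded (fun n => (T ∩ {μ | ∀ i, μ i < n}).ncard)
      fun n => (T ∩ {μ | ∑ i, μ i ≤ n}).ncard := by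
  induction N with
  | zero =>
    by_cases h : T = ∅
    · simpa [h] using IsStanleyBounded.zero
    · obtain rfl : T = Set.univ := Subsingleton.eq_univ_of_nonempty
        (Set.nonempty_iff_ne_empty.2 h)
      simpa using IsStanleyBounded.one
  | succ N ih =>
    let slice : ℕ → Set (Fin N → ℕ) := fun j => {ν | Fin.cons j ν ∈ T}
    have hslice : ∀ j, IsLowerSet (slice j) := fun j ν ν' hle hν =>
      hT (by simpa [Fin.cons_le_cons] using hle) hν
    have hanti : Antitone slice := fun j j' hj ν hν =>
      hT (by simpa [Fin.cons_le_cons] using hj) hν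
    obtain ⟨j₀, hj₀⟩ := exists_forall_slice_subset hslice hanti
    have hbox : ∀ n, (T ∩ {μ | ∀ i, μ i < n}).ncard =
        ∑ j ∈ range n, (slice j ∩ {μ | ∀ i, μ i < n}).ncard := fun n => by
      rw [ncard_eq_sum_slices ((finite_box n).inter_of_right T) fun μ hμ => hμ.2 0]
      refine Finset.sum_congr rfl fun j hj => ?_
      congr 1
      ext ν
      simp [slice, Fin.forall_fin_succ, Finset.mem_range.1 hj]
    have hsimplex : ∀ n, (T ∩ {μ | ∑ i, μ i ≤ n}).ncard =
        ∑ j ∈ range (n + 1), (slice j ∩ {μ | ∑ i, μ i ≤ n - j}).ncard := fun n => by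
      rw [ncard_eq_sum_slices (n := n + 1)]
      · refine Finset.sum_congr rfl fun j hj => ?_
        congr 1
        ext ν
        have := Finset.mem_range.1 hj
        simp only [slice, Set.mem_ofPred_eq, Set.mem_inter_iff, Fin.sum_univ_succ, Fin.cons_zero,
          Fin.cons_succ]
        refine and_congr_right fun _ => ?_
        omega
      · refine ((finite_setOf_sum_lt (n + 1)).inter_of_right T).subset fun μ hμ => ⟨hμ.1, ?_⟩
        exact Nat.lt_succ_of_le hμ.2
      · intro μ hμ
        refine Nat.lt_succ_of_le (le_trans ?_ hμ.2)
        exact Finset.single_le_sum (f := μ) (fun _ _ => Nat.zero_le _) (Finset.mem_univ 0)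
    have hstable : ∀ j, j₀ ≤ j → slice j = slice j₀ := fun j hj =>
      (hanti hj).antisymm (hj₀ j)
    refine ((IsStanleyBounded.sum (fun j => (ih (hslice j)).shift j) j₀).add
      ((ih (hslice j₀)).cone.shift j₀)).mono (fun n => ?_) fun n => ?_
    · rw [hbox]
      rcases le_total n j₀ with hn | hn
      · exact le_add_right (Finset.sum_le_sum_of_subset (Finset.range_mono hn))
      · rw [← Finset.sum_range_add_sum_Ico _ hn]
        gcongr
        rw [Finset.sum_congr rfl fun j hj => by rw [hstable j (Finset.mem_Ico.1 hj).1]]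
        simp only [Finset.sum_const, Nat.card_Ico, smul_eq_mul]
        gcongr
        omega
    · rw [hsimplex]
      by_cases hn : j₀ ≤ n
      · rw [if_pos hn, ← Finset.sum_range_add_sum_Ico _ (hn.trans n.le_succ)]
        refine add_le_add (Finset.sum_le_sum fun j hj => ?_) ?_
        · rw [if_pos (by have := Finset.mem_range.1 hj; omega)]
        · rw [Finset.sum_Ico_eq_sum_range, show n + 1 - j₀ = n - j₀ + 1 by omega,
            ← Finset.sum_range_reflect fun k => (slice j₀ ∩ {μ | ∑ i, μ i ≤ k}).ncard]
          refine le_of_eq (Finset.sum_congr rfl fun k hk => ?_)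
          have := Finset.mem_range.1 hk
          rw [hstable _ (Nat.le_add_right j₀ k),
            show n - j₀ + 1 - 1 - k = n - (j₀ + k) by omega]
      · rw [if_neg hn, add_zero, ← Finset.sum_filter]
        refine Finset.sum_le_sum_of_subset fun j hj => ?_
        simp only [Finset.mem_filter, Finset.mem_range] at hj ⊢
        omega

end Counting

section IntegralClosure

variable {R : Type*} [CommRing R]

lemma sup_pow_succ_le (K J : Ideal R) (i : ℕ) :
    (K ⊔ J) ^ (i + 1) ≤ K * (K ⊔ J) ^ i ⊔ J ^ (i + 1) := by
  induction i with
  | zero => simp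
  | succ i ih =>
    rw [pow_succ (K ⊔ J) (i + 1)]
    rw [Ideal.mul_sup]
    refine sup_le ?_ ?_
    · rw [mul_comm]
      exact le_sup_left
    · refine (Ideal.mul_mono_left ih).trans ?_
      rw [Ideal.sup_mul, ← pow_succ, mul_assoc]
      refine sup_le_sup_right (Ideal.mul_mono_right ?_) _
      rw [pow_succ]
      exact Ideal.mul_mono_right le_sup_right

lemma exists_sup_span_singleton_pow_le {I K : Ideal R} (hIK : I ≤ K) {y : R}
    (hy : y ∈ integralOverIdeal I) :
    ∃ k, ∀ n, (K ⊔ Ideal.span {y}) ^ (n + k) ≤ K ^ n := by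
  obtain ⟨m, hm, a, ha, h⟩ := hy
  obtain ⟨m, rfl⟩ := Nat.exists_eq_succ_of_ne_zero hm.ne'
  set L := K ⊔ Ideal.span {y} with hL
  have hyL : y ∈ L := Ideal.mem_sup_right (Ideal.mem_span_singleton_self y)
  have hpow : L ^ (m + 1) ≤ K * L ^ m := by
    refine (sup_pow_succ_le K (Ideal.span {y}) m).trans (sup_le le_rfl ?_)
    rw [Ideal.span_singleton_pow, Ideal.span_singleton_le_iff_mem, eq_neg_of_add_eq_zero_left h]
    refine neg_mem (Ideal.sum_mem _ fun j hj => ?_)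
    obtain ⟨h1, h2⟩ := Finset.mem_Icc.1 hj
    have hmem : a j * y ^ (m.succ - j) ∈ K ^ j * L ^ (m.succ - j) :=
      Ideal.mul_mem_mul (Ideal.pow_right_mono hIK j (ha j h1 h2)) (Ideal.pow_mem_pow hyL _)
    refine (?_ : K ^ j * L ^ (m.succ - j) ≤ K * L ^ m) hmem
    obtain ⟨j, rfl⟩ := Nat.exists_eq_succ_of_ne_zero (Nat.one_le_iff_ne_zero.1 h1)
    rw [Nat.succ_eq_add_one, pow_succ', mul_assoc]
    refine Ideal.mul_mono_right ((Ideal.mul_mono_left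
      (Ideal.pow_right_mono (le_sup_left : K ≤ L) j)).trans ?_)
    rw [← pow_add]
    exact le_of_eq (by congr 1; omega)
  refine ⟨m, fun n => (?_ : L ^ (n + m) ≤ K ^ n * L ^ m).trans
    (Ideal.mul_le_inf.trans inf_le_left)⟩
  induction n with
  | zero => simp
  | succ n ih =>
    rw [add_right_comm, pow_succ]
    refine (Ideal.mul_mono_left ih).trans ?_
    rw [mul_assoc, ← pow_succ, pow_succ K, mul_assoc]
    exact Ideal.mul_mono_right hpow

lemma exists_idealIntegralClosure_pow_le [IsNoetherianRing R] (I : Ideal R) :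
    ∃ k, ∀ n, idealIntegralClosure I ^ (n + k) ≤ I ^ n := by
  classical
  obtain ⟨t, htS, ht⟩ := (Submodule.fg_span_iff_fg_span_finset_subset (integralOverIdeal I)).1
    (IsNoetherian.noetherian (idealIntegralClosure I))
  have key : ∀ t : Finset R, (t : Set R) ⊆ integralOverIdeal I →
      ∃ k, ∀ n, (I ⊔ Ideal.span (t : Set R)) ^ (n + k) ≤ I ^ n := by
    intro t
    induction t using Finset.induction_on with
    | empty => exact fun _ => ⟨0, by simp⟩
    | insert y t _ ih =>
      intro hsub
      rw [Finset.coe_insert, Set.insert_subset_iff] at hsub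
      obtain ⟨k, hk⟩ := ih hsub.2
      obtain ⟨l, hl⟩ := exists_sup_span_singleton_pow_le
        (le_sup_left : I ≤ I ⊔ Ideal.span (t : Set R)) hsub.1
      refine ⟨k + l, fun n => ?_⟩
      rw [Finset.coe_insert, Ideal.span_insert, sup_comm (Ideal.span {y}), ← sup_assoc, ← add_assoc]
      exact (hl _).trans (hk n)
  obtain ⟨k, hk⟩ := key t htS
  refine ⟨k, fun n => le_trans (Ideal.pow_right_mono ?_ _) (hk n)⟩
  exact (le_of_eq ht).trans le_sup_right

end IntegralClosure

section Asymptotics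

open Filter Topology

/-- The value at `n` of the polynomial with Hilbert coefficients `e 0, …, e d`. -/
def hilbertValue (d : ℕ) (e : ℕ → ℤ) (n : ℕ) : ℤ :=
  ∑ i ∈ Finset.range (d + 1), (-1 : ℤ) ^ i * e i * ((n + d - i).choose (d - i))

lemma tendsto_choose_div_pow (f : ℕ) :
    Tendsto (fun n : ℕ => ((n.choose f : ℕ) : ℝ) / (n : ℝ) ^ f) atTop (𝓝 (1 / f.factorial)) := by
  have h := isEquivalent_choose f
  have h1 := (Asymptotics.isEquivalent_iff_tendsto_one ?_).1 h
  · have h2 := h1.div_const (f.factorial : ℝ)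
    refine h2.congr' ?_
    filter_upwards [eventually_gt_atTop 0] with n hn
    have : (n : ℝ) ≠ 0 := by positivity
    simp only [Pi.div_apply]
    field_simp
  · filter_upwards [eventually_gt_atTop 0] with n hn
    positivity

lemma tendsto_add_pow_div_pow (a f : ℕ) :
    Tendsto (fun n : ℕ => ((n : ℝ) + a) ^ f / (n : ℝ) ^ f) atTop (𝓝 1) := by
  have h : Tendsto (fun n : ℕ => (1 + (a : ℝ) / n) ^ f) atTop (𝓝 ((1 + 0) ^ f)) :=
    ((tendsto_const_div_atTop_nhds_zero_nat (a : ℝ)).const_add 1).pow f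
  rw [add_zero, one_pow] at h
  refine h.congr' ?_
  filter_upwards [eventually_gt_atTop 0] with n hn
  have : (n : ℝ) ≠ 0 := by positivity
  rw [← div_pow]
  congr 1
  field_simp

lemma tendsto_add_choose_div_pow (a f : ℕ) :
    Tendsto (fun n : ℕ => (((n + a).choose f : ℕ) : ℝ) / (n : ℝ) ^ f) atTop
      (𝓝 (1 / f.factorial)) := by
  have h := ((tendsto_choose_div_pow f).comp (tendsto_add_atTop_nat a)).mul
    (tendsto_add_pow_div_pow a f)
  rw [mul_one] at h
  refine h.congr' ?_
  filter_upwards [eventually_gt_atTop 0] with n hn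
  have : (n : ℝ) ≠ 0 := by positivity
  have : (n : ℝ) + a ≠ 0 := by positivity
  simp only [Function.comp_apply, Nat.cast_add]
  field_simp

lemma tendsto_div_pow_of_le {u : ℕ → ℝ} {f d : ℕ} {c : ℝ} (hfd : f ≤ d)
    (h : Tendsto (fun n => u n / (n : ℝ) ^ f) atTop (𝓝 c)) :
    Tendsto (fun n => u n / (n : ℝ) ^ d) atTop (𝓝 (if f = d then c else 0)) := by
  split_ifs with hd
  · rwa [← hd]
  · obtain ⟨k, rfl⟩ := Nat.exists_eq_add_of_le hfd
    have hk : k ≠ 0 := by omega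
    have h0 : Tendsto (fun n : ℕ => (n : ℝ)⁻¹ ^ k) atTop (𝓝 (0 ^ k)) :=
      tendsto_inv_atTop_nhds_zero_nat.pow k
    have h1 := h.mul h0
    rw [zero_pow hk, mul_zero] at h1
    refine h1.congr fun n => ?_
    rw [pow_add, div_mul_eq_div_div, inv_pow, div_eq_mul_inv (u n / (n : ℝ) ^ f)]

lemma tendsto_list_sum_map {α : Type*} (L : List α) {u : α → ℕ → ℝ} {c : α → ℝ}
    (h : ∀ p ∈ L, Tendsto (u p) atTop (𝓝 (c p))) :
    Tendsto (fun n => (L.map fun p => u p n).sum) atTop (𝓝 (L.map c).sum) := by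
  induction L with
  | nil => simp
  | cons p L ih =>
    simp only [List.map_cons, List.sum_cons]
    exact (h p (by simp)).add (ih fun q hq => h q (by simp [hq]))

lemma tendsto_hilbertValue_div_pow (d : ℕ) (e : ℕ → ℤ) :
    Tendsto (fun n => (hilbertValue d e n : ℝ) / (n : ℝ) ^ d) atTop
      (𝓝 (e 0 / d.factorial)) := by
  have h : ∀ i ∈ Finset.range (d + 1), Tendsto
      (fun n : ℕ => ((-1) ^ i * e i) * ((((n + (d - i)).choose (d - i) : ℕ) : ℝ) / (n : ℝ) ^ d))
      atTop (𝓝 (((-1) ^ i * e i) * if d - i = d then 1 / ((d - i).factorial : ℝ) else 0)) :=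
    fun i _ => (tendsto_div_pow_of_le (Nat.sub_le d i)
      (tendsto_add_choose_div_pow (d - i) (d - i))).const_mul _
  have h := tendsto_finsetSum _ h
  have hlim : ∑ i ∈ Finset.range (d + 1),
      ((-1 : ℝ) ^ i * e i) * (if d - i = d then 1 / ((d - i).factorial : ℝ) else 0)
        = e 0 / d.factorial := by
    rw [Finset.sum_eq_single 0]
    · simp [div_eq_mul_inv]
    · intro i hi h0
      rw [Finset.mem_range] at hi
      rw [if_neg (by omega), mul_zero]
    · simp
  rw [hlim] at h
  refine h.congr fun n => ?_
  rw [hilbertValue]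
  push_cast
  rw [Finset.sum_div]
  refine Finset.sum_congr rfl fun i hi => ?_
  rw [Finset.mem_range] at hi
  rw [show n + d - i = n + (d - i) by omega, mul_div_assoc]

lemma tendsto_shifted_choose_div_pow (b f : ℕ) :
    Tendsto (fun n : ℕ => ((if b ≤ n then (n - b + f).choose f else 0 : ℕ) : ℝ) / (n : ℝ) ^ f)
      atTop (𝓝 (1 / f.factorial)) := by
  rw [← tendsto_add_atTop_iff_nat b]
  have h := (tendsto_add_choose_div_pow f f).div (tendsto_add_pow_div_pow b f) one_ne_zero
  rw [div_one] at h
  refine h.congr' ?_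
  filter_upwards [eventually_gt_atTop 0] with n hn
  have : (n : ℝ) ≠ 0 := by positivity
  have : (n : ℝ) + b ≠ 0 := by positivity
  simp only [Pi.div_apply, le_add_iff_nonneg_left, zero_le, if_true, Nat.add_sub_cancel, Nat.cast_add]
  field_simp

lemma coeff_zero_le_of_eventually_le {d : ℕ} {e e' : ℕ → ℤ} {L : List (ℕ × ℕ)} {k l : ℕ}
    (h1 : ∀ᶠ n in atTop,
      (((L.map fun p => if p.1 ≤ n then (n - p.1 + p.2).choose p.2 else 0).sum : ℕ) : ℤ)
        ≤ hilbertValue d e' n)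
    (h2 : ∀ᶠ n in atTop,
      hilbertValue d e n ≤ (l * (L.map fun p => (n + k) ^ p.2).sum : ℕ)) :
    e 0 ≤ d.factorial * l * e' 0 := by
  have hle : ∀ p ∈ L, p.2 ≤ d := by
    intro p hp
    by_contra! hlt
    obtain ⟨j, hj⟩ := Nat.exists_eq_add_of_lt hlt
    have ht : Tendsto (fun n : ℕ =>
        ((if p.1 ≤ n then (n - p.1 + p.2).choose p.2 else 0 : ℕ) : ℝ) / (n : ℝ) ^ d)
        atTop atTop := by
      refine ((tendsto_shifted_choose_div_pow p.1 p.2).pos_mul_atTop (by positivity)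
        ((tendsto_pow_atTop (Nat.succ_ne_zero j)).comp tendsto_natCast_atTop_atTop)).congr' ?_
      filter_upwards [eventually_gt_atTop 0] with n hn
      have : (n : ℝ) ≠ 0 := by positivity
      rw [hj, Nat.succ_eq_add_one, add_assoc d, pow_add]
      simp only [Function.comp_apply]
      field_simp
    refine not_tendsto_nhds_of_tendsto_atTop (tendsto_atTop_mono' _ ?_ ht) _
      (tendsto_hilbertValue_div_pow d e')
    filter_upwards [h1] with n hn
    refine div_le_div_of_nonneg_right ?_ (by positivity)
    have : (if p.1 ≤ n then (n - p.1 + p.2).choose p.2 else 0) ≤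
        (L.map fun p => if p.1 ≤ n then (n - p.1 + p.2).choose p.2 else 0).sum :=
      List.single_le_sum (fun _ _ => Nat.zero_le _) _ (List.mem_map_of_mem hp)
    exact_mod_cast (Int.ofNat_le.2 this).trans hn
  set c : ℝ := (L.map fun p => if p.2 = d then (1 : ℝ) else 0).sum with hc
  have hc1 : c / d.factorial ≤ e' 0 / d.factorial := by
    have ht := tendsto_list_sum_map L fun p hp => tendsto_div_pow_of_le (hle p hp)
      (tendsto_shifted_choose_div_pow p.1 p.2)
    have hlim : (L.map fun p => if p.2 = d then 1 / (p.2.factorial : ℝ) else 0).sum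
        = c / d.factorial := by
      rw [hc, div_eq_mul_inv, ← List.sum_map_mul_right]
      congr 1
      refine List.map_congr_left fun p _ => ?_
      split_ifs with h <;> simp [h]
    rw [hlim] at ht
    refine le_of_tendsto_of_tendsto ht (tendsto_hilbertValue_div_pow d e') ?_
    filter_upwards [h1] with n hn
    simp only [div_eq_mul_inv]
    rw [List.sum_map_mul_right]
    refine mul_le_mul_of_nonneg_right ?_ (by positivity)
    have : (((L.map fun p => if p.1 ≤ n then (n - p.1 + p.2).choose p.2 else 0).sum : ℕ) : ℝ)
        ≤ hilbertValue d e' n := by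
      rw [← Int.cast_natCast]
      exact Int.cast_le.2 hn
    refine le_of_eq_of_le ?_ this
    rw [Nat.cast_list_sum, List.map_map]
    rfl
  have hc2 : (e 0 : ℝ) / d.factorial ≤ l * c := by
    have ht := (tendsto_list_sum_map L fun p hp => tendsto_div_pow_of_le (hle p hp)
      (tendsto_add_pow_div_pow k p.2)).const_mul (l : ℝ)
    refine le_of_tendsto_of_tendsto (tendsto_hilbertValue_div_pow d e) ht ?_
    filter_upwards [h2] with n hn
    simp only [div_eq_mul_inv]
    rw [List.sum_map_mul_right, ← mul_assoc]
    refine mul_le_mul_of_nonneg_right ?_ (by positivity)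
    have : (hilbertValue d e n : ℝ) ≤ ((l * (L.map fun p => (n + k) ^ p.2).sum : ℕ) : ℝ) := by
      rw [← Int.cast_natCast]
      exact Int.cast_le.2 hn
    refine this.trans_eq ?_
    rw [Nat.cast_mul, Nat.cast_list_sum, List.map_map]
    congr 2
    refine List.map_congr_left fun p _ => ?_
    simp
  have hd : (0 : ℝ) < d.factorial := by positivity
  rw [div_le_div_iff_of_pos_right hd] at hc1
  rw [div_le_iff₀ hd] at hc2
  have : (e 0 : ℝ) ≤ d.factorial * l * e' 0 := by
    have := mul_le_mul_of_nonneg_left hc1 (by positivity : (0 : ℝ) ≤ l * d.factorial)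
    linarith
  exact_mod_cast this

end Asymptotics

section Lech

variable {R : Type*} [CommRing R]

lemma HasHilbertCoeffs.exists_length_eq {I : Ideal R} {d : ℕ} {e : ℕ → ℤ}
    (h : HasHilbertCoeffs I d e) : ∃ N, ∀ n ≥ N, ∃ l : ℕ,
      Module.length R (R ⧸ I ^ (n + 1)) = l ∧ (l : ℤ) = hilbertValue d e n := by
  obtain ⟨N, hN⟩ := h
  refine ⟨N, fun n hn => ?_⟩
  obtain ⟨l, h1, h2⟩ := hN n hn
  refine ⟨l, ?_, h2⟩
  rw [moduleLength, ← Module.coe_length] at h1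
  exact_mod_cast h1

lemma le_idealIntegralClosure (I : Ideal R) : I ≤ idealIntegralClosure I := by
  refine fun y hy => Ideal.subset_span ⟨1, one_pos, fun _ => -y, fun j h1 h2 => ?_, by simp⟩
  obtain rfl : j = 1 := le_antisymm h2 h1
  simpa using hy

/-- **Lech's inequality**, with the integral closure of the ideal. -/
lemma coeff_zero_le_factorial_mul_length_mul_coeff_zero [IsNoetherianRing R] [IsLocalRing R]
    {I : Ideal R} {c : ℕ} (hc : maximalIdeal R ^ c ≤ I) {d : ℕ} {e e' : ℕ → ℤ}
    (he : HasHilbertCoeffs I d e) (he' : HasHilbertCoeffs (maximalIdeal R) d e') {l : ℕ}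
    (hl : Module.length R (R ⧸ idealIntegralClosure I) = l) :
    e 0 ≤ d.factorial * l * e' 0 := by
  obtain ⟨N, y, hy⟩ := Submodule.fg_iff_exists_fin_generating_family.1
    (IsNoetherian.noetherian (maximalIdeal R))
  have hT : IsLowerSet (initialExponents y (⊥ : Ideal R))ᶜ := by
    intro μ ν hνμ hμ hν
    refine hμ ?_
    have := add_mem_initialExponents y hν (μ - ν)
    rwa [add_tsub_cancel_of_le hνμ] at this
  obtain ⟨L, hL⟩ := isStanleyBounded_of_isLowerSet hT
  obtain ⟨k, hk⟩ := exists_idealIntegralClosure_pow_le I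
  obtain ⟨N₁, h₁⟩ := he.exists_length_eq
  obtain ⟨N₂, h₂⟩ := he'.exists_length_eq
  have hfin : ∀ n, ((initialExponents y (⊥ : Ideal R))ᶜ ∩ {μ | ∑ i, μ i ≤ n}).Finite := fun n =>
    (finite_setOf_sum_lt (n + 1)).subset fun μ hμ => Nat.lt_succ_of_le hμ.2
  refine coeff_zero_le_of_eventually_le (L := L) (k := 1 + k) (l := l) ?_ ?_
  · filter_upwards [Filter.eventually_ge_atTop N₂] with n hn
    obtain ⟨a, ha1, ha2⟩ := h₂ n hn
    rw [← ha2, Int.ofNat_le]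
    refine (hL n).2.trans ?_
    have h := encard_le_length_quotient_pow hy n
    rw [ha1, ← (hfin n).cast_ncard_eq] at h
    exact_mod_cast h
  · filter_upwards [Filter.eventually_ge_atTop N₁] with n hn
    obtain ⟨a, ha1, ha2⟩ := h₁ n hn
    rw [← ha2, Int.ofNat_le]
    refine le_trans ?_ (Nat.mul_le_mul_left l (hL _).1)
    have h := (length_quotient_anti (hk (n + 1))).trans (length_quotient_pow_le hy
      (hc.trans (le_idealIntegralClosure I)) (by omega : 0 < n + 1 + k))
    rw [ha1, hl, ← ((finite_box _).subset Set.inter_subset_right).cast_ncard_eq] at h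
    rw [← add_assoc]
    exact_mod_cast h

end Lech

section GenericElement

open Polynomial

variable {R : Type*} [CommRing R]

/-- A filtered version of McCoy's theorem on zero divisors of polynomials. -/
lemma coeff_mem_of_coeff_mul_mem {x : R[X]} {A B : ℕ → Ideal R} {n₀ : ℕ}
    (hA : ∀ n i, ∀ a ∈ A n, x.coeff i * a ∈ A (n + 1))
    (hB : ∀ n i, ∀ a ∈ B n, x.coeff i * a ∈ B (n + 1))
    (h : ∀ n ≥ n₀, ∀ a ∈ A n, (∀ i, x.coeff i * a ∈ B (n + 1)) → a ∈ B n)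
    {n : ℕ} (hn : n₀ ≤ n) {f : R[X]} (hf : ∀ j, f.coeff j ∈ A n)
    (hxf : ∀ j, (x * f).coeff j ∈ B (n + 1)) (j : ℕ) : f.coeff j ∈ B n := by
  obtain ⟨m, hm⟩ : ∃ m : ℕ, ∀ j ≥ m, f.coeff j = 0 := ⟨f.natDegree + 1, fun j hj =>
    coeff_eq_zero_of_natDegree_lt hj⟩
  induction m generalizing f n j with
  | zero => simp [hm j (Nat.zero_le j)]
  | succ m ih =>
    suffices H : ∀ t i, x.natDegree < i + t → ∀ j, x.coeff i * f.coeff j ∈ B (n + 1) from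
      h n hn _ (hf j) fun i => H (x.natDegree + 1) i (by omega) j
    intro t
    induction t with
    | zero =>
      intro i hi j
      rw [coeff_eq_zero_of_natDegree_lt (by omega), zero_mul]
      exact zero_mem _
    | succ t iht =>
      intro i hi
      have hlead : x.coeff i * f.coeff m ∈ B (n + 1) := by
        have := hxf (i + m)
        rw [coeff_mul, ← Finset.add_sum_erase _ _
          (HasAntidiagonal.mem_antidiagonal.2 rfl : (i, m) ∈ _)] at this
        refine (Ideal.add_mem_iff_left _ (Ideal.sum_mem _ fun p hp => ?_)).1 this
        obtain ⟨hne, hp⟩ := Finset.mem_erase.1 hp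
        rw [HasAntidiagonal.mem_antidiagonal] at hp
        rcases lt_trichotomy p.1 i with hlt | heq | hgt
        · rw [hm p.2 (by omega), mul_zero]
          exact zero_mem _
        · exact absurd (Prod.ext heq (by simp only; omega)) hne
        · exact iht p.1 (by omega) p.2
      have hcoeff : ∀ j, (C (x.coeff i) * (f - C (f.coeff m) * X ^ m)).coeff j =
          if j = m then 0 else x.coeff i * f.coeff j := by
        intro j
        rw [coeff_C_mul, coeff_sub, coeff_C_mul_X_pow]
        split_ifs with hj <;> simp [hj]
      have hg : ∀ j, (C (x.coeff i) * (f - C (f.coeff m) * X ^ m)).coeff j ∈ B (n + 1) := by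
        refine fun j => ih (by omega) (fun j => ?_) (fun j => ?_) j fun j hj => ?_
        · rw [hcoeff]
          split_ifs
          · exact zero_mem _
          · exact hA _ _ _ (hf j)
        · have heq : x * (C (x.coeff i) * (f - C (f.coeff m) * X ^ m)) =
              C (x.coeff i) * (x * f) - x * C (x.coeff i * f.coeff m) * X ^ m := by
            rw [C_mul]
            ring
          rw [heq, coeff_sub, coeff_C_mul, coeff_mul_X_pow']
          refine sub_mem (hB _ _ _ (hxf j)) ?_
          split_ifs
          · rw [coeff_mul_C]
            exact hB _ _ _ hlead
          · exact zero_mem _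
        · rw [hcoeff]
          split_ifs with hjm
          · rfl
          · rw [hm j (by omega), mul_zero]
      intro j
      by_cases hj : j = m
      · rwa [hj]
      · simpa only [hcoeff, if_neg hj] using hg j

lemma exists_mem_pow_of_forall_mul_mem [IsNoetherianRing R] (I : Ideal R) :
    ∃ n₀, ∀ n ≥ n₀, ∀ a ∈ I ^ n, (∀ i ∈ I, i * a ∈ I ^ (n + 2)) → a ∈ I ^ (n + 1) := by
  let F : I.Filtration R :=
    { N := fun n => I ^ n ⊓ {
        carrier := {a | ∀ i ∈ I, i * a ∈ I ^ (n + 2)}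
        add_mem' := fun ha hb i hi => by rw [mul_add]; exact add_mem (ha i hi) (hb i hi)
        zero_mem' := fun i _ => by simp
        smul_mem' := fun r a ha i hi => by
          rw [smul_eq_mul, mul_left_comm]
          exact Ideal.mul_mem_left _ _ (ha i hi) }
      mono := fun n a ha => ⟨Ideal.pow_le_pow_right n.le_succ ha.1, fun i hi =>
        Ideal.pow_le_pow_right (by omega) (ha.2 i hi)⟩
      smul_le := fun n => Submodule.smul_le.2 fun r hr a ha => ⟨by
        rw [pow_succ']; exact Ideal.mul_mem_mul hr ha.1, fun i hi => by
        rw [smul_eq_mul, mul_left_comm, add_right_comm, pow_succ']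
        exact Ideal.mul_mem_mul hr (ha.2 i hi)⟩ }
  have hF : F ≤ I.stableFiltration (⊤ : Submodule R R) := fun n a ha => by
    simpa using ha.1
  obtain ⟨n₀, h⟩ := (I.stableFiltration_stable (⊤ : Submodule R R)).of_le hF
  refine ⟨n₀ + 1, fun n hn a ha hIa => ?_⟩
  obtain ⟨k, rfl⟩ := Nat.exists_eq_add_of_le' (le_trans (Nat.le_add_left 1 n₀) hn)
  have hmem : a ∈ F.N (k + 1) := ⟨ha, hIa⟩
  rw [← h k (by omega)] at hmem
  refine (Submodule.smul_le.2 fun r hr b hb => ?_ : I • F.N k ≤ I ^ (k + 2)) hmem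
  exact hb.2 r hr

end GenericElement

section Superficial

variable {R : Type*} [CommRing R] [IsNoetherianRing R]

lemma exists_forall_mul_mem_pow_iff {I : Ideal R} {x : R} (hxI : x ∈ I) (hx : IsSMulRegular R x)
    (h : ∃ n₀, ∀ n ≥ n₀, ∀ u ∈ I ^ n, x * u ∈ I ^ (n + 2) → u ∈ I ^ (n + 1)) :
    ∃ n₀, ∀ n ≥ n₀, ∀ u, u ∈ I ^ n ↔ x * u ∈ I ^ (n + 1) := by
  obtain ⟨n₀, h⟩ := h
  obtain ⟨k, hk⟩ := Ideal.exists_pow_inf_eq_pow_smul I (Ideal.span {x})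
  refine ⟨n₀ + k, fun n hn u => ⟨fun hu => by rw [pow_succ']; exact Ideal.mul_mem_mul hxI hu,
    fun hu => ?_⟩⟩
  have hstart : u ∈ I ^ (n - k) := by
    have hmem : x * u ∈ I ^ n • (⊤ : Ideal R) ⊓ Ideal.span {x} :=
      ⟨by simpa using Ideal.pow_le_pow_right n.le_succ hu,
        Ideal.mul_mem_right _ _ (Ideal.mem_span_singleton_self x)⟩
    rw [hk n (by omega)] at hmem
    have hmem' : x * u ∈ I ^ (n - k) * Ideal.span {x} :=
      Ideal.mul_mono_right inf_le_right hmem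
    obtain ⟨v, hv, hvx⟩ := Ideal.mem_mul_span_singleton.1 hmem'
    have : v = u := hx (by simpa only [smul_eq_mul, mul_comm x] using hvx)
    exact this ▸ hv
  have hclimb : ∀ j, n - k + j ≤ n → u ∈ I ^ (n - k + j) := by
    intro j
    induction j with
    | zero => exact fun _ => hstart
    | succ j ih =>
      exact fun hj => h (n - k + j) (by omega) u (ih (by omega)) (Ideal.pow_le_pow_right (by omega) hu)
  simpa [show n - k + k = n by omega] using hclimb k (by omega)

end Superficial

section NagataRing

open Polynomial

universe u

variable (R : Type u) [CommRing R] [IsLocalRing R]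

instance isPrime_map_C_maximalIdeal : ((maximalIdeal R).map (C : R →+* R[X])).IsPrime :=
  Ideal.isPrime_map_C_of_isPrime

/-- The ring `R(X)`, the localization of `R[X]` at the extension of the maximal ideal of `R`. -/
abbrev NagataRing : Type u := Localization.AtPrime ((maximalIdeal R).map (C : R →+* R[X]))

namespace NagataRing

lemma map_maximalIdeal :
    (maximalIdeal R).map (algebraMap R (NagataRing R)) = maximalIdeal (NagataRing R) := by
  rw [← Localization.AtPrime.map_eq_maximalIdeal, Ideal.map_map]
  rfl

instance flat : Module.Flat R (NagataRing R) :=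
  have : Module.Flat R[X] (NagataRing R) :=
    IsLocalization.flat _ ((maximalIdeal R).map (C : R →+* R[X])).primeCompl
  Module.Flat.trans R R[X] (NagataRing R)

instance isLocalHom : IsLocalHom (algebraMap R (NagataRing R)) :=
  ((local_hom_TFAE _).out 0 2).2 (map_maximalIdeal R).le

variable {R}

open TensorProduct in
lemma length_quotient_map (A : Ideal R) :
    Module.length (NagataRing R) (NagataRing R ⧸ A.map (algebraMap R (NagataRing R))) =
      Module.length R (R ⧸ A) := by
  have h := IsLocalRing.length_baseChange R (NagataRing R) (R ⧸ A)
  rw [map_maximalIdeal, length_quotient_maximalIdeal, mul_one,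
    ← (Algebra.TensorProduct.quotIdealMapEquivTensorQuot (NagataRing R) A).toLinearEquiv.length_eq]
    at h
  exact h

lemma exists_mul_eq_algebraMap (u : NagataRing R) :
    ∃ s : NagataRing R, IsUnit s ∧ ∃ f : R[X], u * s = algebraMap R[X] (NagataRing R) f := by
  obtain ⟨⟨f, s⟩, h⟩ := IsLocalization.surj ((maximalIdeal R).map (C : R →+* R[X])).primeCompl u
  exact ⟨_, IsLocalization.map_units _ s, f, h⟩

lemma algebraMap_mem_map_iff {A : Ideal R} {f : R[X]} :
    algebraMap R[X] (NagataRing R) f ∈ A.map (algebraMap R (NagataRing R)) ↔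
      ∀ j, f.coeff j ∈ A := by
  have hA : A.map (algebraMap R (NagataRing R)) =
      (A.map (C : R →+* R[X])).map (algebraMap R[X] (NagataRing R)) := by
    rw [Ideal.map_map]
    rfl
  rw [hA, ← Ideal.mem_map_C_iff]
  refine ⟨fun h => ?_, Ideal.mem_map_of_mem _⟩
  obtain ⟨s, hs, hsf⟩ := (IsLocalization.algebraMap_mem_map_algebraMap_iff
    ((maximalIdeal R).map (C : R →+* R[X])).primeCompl _ _ _).1 h
  have hs' : ¬ ∀ i, s.coeff i ∈ maximalIdeal R := fun h => hs (Ideal.mem_map_C_iff.2 h)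
  obtain ⟨i, hi⟩ := not_forall.1 hs'
  rw [mem_maximalIdeal, mem_nonunits_iff, not_not] at hi
  rw [Ideal.mem_map_C_iff] at hsf ⊢
  refine coeff_mem_of_coeff_mul_mem (x := s) (A := fun _ => ⊤) (B := fun _ => A) (n₀ := 0)
    (n := 0) (fun _ _ _ _ => trivial) (fun _ _ a ha => A.mul_mem_left _ ha)
    (fun _ _ a _ ha => ?_) le_rfl (fun _ => trivial) hsf
  exact (Ideal.unit_mul_mem_iff_mem A hi).1 (ha i)

variable (x : R[X])

lemma algebraMap_mul_mem_map_pow {I : Ideal R} [IsNoetherianRing R]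
    (hx : Ideal.span (Set.range x.coeff) = I) : ∃ n₀, ∀ n ≥ n₀, ∀ u : NagataRing R,
      u ∈ I.map (algebraMap R (NagataRing R)) ^ n →
      algebraMap R[X] (NagataRing R) x * u ∈ I.map (algebraMap R (NagataRing R)) ^ (n + 2) →
      u ∈ I.map (algebraMap R (NagataRing R)) ^ (n + 1) := by
  obtain ⟨n₀, h⟩ := exists_mem_pow_of_forall_mul_mem I
  have hxI : ∀ i, x.coeff i ∈ I := fun i => hx ▸ Ideal.subset_span (Set.mem_range_self i)
  refine ⟨n₀, fun n hn u hu hxu => ?_⟩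
  obtain ⟨s, hs, f, hf⟩ := exists_mul_eq_algebraMap u
  simp only [← Ideal.map_pow] at hu hxu ⊢
  rw [← Ideal.mul_unit_mem_iff_mem _ hs, hf] at hu ⊢
  rw [← Ideal.mul_unit_mem_iff_mem _ hs, mul_assoc, hf, ← map_mul] at hxu
  rw [algebraMap_mem_map_iff] at hu hxu ⊢
  refine coeff_mem_of_coeff_mul_mem (x := x) (A := fun n => I ^ n) (B := fun n => I ^ (n + 1))
    (fun n i a ha => ?_) (fun n i a ha => ?_) (fun n hn a ha hia => h n hn a ha ?_) hn hu hxu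
  · rw [pow_succ']
    exact Ideal.mul_mem_mul (hxI i) ha
  · rw [pow_succ' _ (n + 1)]
    exact Ideal.mul_mem_mul (hxI i) ha
  · intro i hi
    rw [← hx] at hi
    refine (Ideal.span_le (I := Submodule.comap (LinearMap.mulRight R a) (I ^ (n + 2)))).2 ?_ hi
    rintro _ ⟨i, rfl⟩
    exact hia i

lemma isSMulRegular_algebraMap (hx : ∀ a, (∀ i, x.coeff i * a = 0) → a = 0) :
    IsSMulRegular (NagataRing R) (algebraMap R[X] (NagataRing R) x) := by
  refine (isSMulRegular_iff_right_eq_zero_of_smul (M := NagataRing R)).2 fun u hu => ?_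
  obtain ⟨s, hs, f, hf⟩ := exists_mul_eq_algebraMap u
  have h0 : ∀ g : R[X], algebraMap R[X] (NagataRing R) g = 0 ↔ ∀ j, g.coeff j ∈ (⊥ : Ideal R) :=
    fun g => by rw [← algebraMap_mem_map_iff, Ideal.map_bot, Ideal.mem_bot]
  rw [← hs.mul_left_eq_zero, hf, h0]
  refine coeff_mem_of_coeff_mul_mem (x := x) (A := fun _ => ⊤) (B := fun _ => ⊥) (n₀ := 0)
    (n := 0) (fun _ _ _ _ => trivial) (fun _ _ a ha => Ideal.mul_mem_left _ _ ha)
    (fun _ _ a _ ha => hx a ha) le_rfl (fun _ => trivial) ?_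
  rw [← h0, map_mul, ← hf, ← mul_assoc, ← smul_eq_mul (algebraMap _ _ x), hu, zero_mul]

end NagataRing
end NagataRing

section Depth

open RingTheory.Sequence CategoryTheory CategoryTheory.Abelian
open scoped Pointwise

universe u

variable {R : Type u} [CommRing R] [IsLocalRing R] [IsNoetherianRing R]

lemma exists_isRegular_quotSMulTop {rs : List R} (hmem : ∀ r ∈ rs, r ∈ maximalIdeal R)
    (hreg : IsWeaklyRegular R rs) {n : ℕ} (hlen : rs.length = n + 1) {x : R}
    (hxm : x ∈ maximalIdeal R) (hx : IsSMulRegular R x) :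
    ∃ rs' : List R, rs'.length = n ∧ (∀ r ∈ rs', r ∈ maximalIdeal R) ∧
      IsRegular (QuotSMulTop x R) rs' := by
  have hlt (M : Type u) [AddCommGroup M] [Module R M] [Module.Finite R M] [Nontrivial M] :
      maximalIdeal R • (⊤ : Submodule R M) < ⊤ :=
    (Submodule.top_ne_ideal_smul_of_le_jacobson_annihilator
      (maximalIdeal_le_jacobson _)).symm.lt_top
  have : Nontrivial (QuotSMulTop x R) := nontrivial_quotSMulTop_of_mem_maximalIdeal R hxm
  have hsupp : Module.support R (ModuleCat.of R (R ⧸ maximalIdeal R)) =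
      PrimeSpectrum.zeroLocus (maximalIdeal R) := by
    rw [Module.support_eq_zeroLocus]
    exact congrArg _ (congrArg _ (Ideal.annihilator_quotient))
  have hext := ModuleCat.subsingleton_ext_of_exists_isRegular (maximalIdeal R)
    (ModuleCat.of R (R ⧸ maximalIdeal R)) hsupp.le (ModuleCat.of R R) (hlt R) rs hmem
    (IsRegular.of_isWeaklyRegular_of_mem_maximalIdeal R hmem hreg)
  refine ModuleCat.exists_isRegular_of_exists_subsingleton_ext (maximalIdeal R) n
    (ModuleCat.of R (QuotSMulTop x R)) (hlt _) _ hsupp fun i hi => ?_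
  have hx' : IsSMulRegular (ModuleCat.of R R) x := hx
  have zero1 := AddCommGrpCat.isZero_of_iff_subsingleton.mpr (hext i (by omega))
  have zero2 := AddCommGrpCat.isZero_of_iff_subsingleton.mpr (hext (i + 1) (by omega))
  exact AddCommGrpCat.subsingleton_of_isZero <| ShortComplex.Exact.isZero_of_both_zeros
    ((Ext.covariant_sequence_exact₃' _ hx'.smulShortComplex_shortExact) i (i + 1) rfl)
    (zero1.eq_zero_of_src _) (zero2.eq_zero_of_tgt _)

lemma exists_isWeaklyRegular_quotient {rs : List R} (hmem : ∀ r ∈ rs, r ∈ maximalIdeal R)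
    (hreg : IsWeaklyRegular R rs) {n : ℕ} (hlen : rs.length = n + 1) {x : R}
    (hxm : x ∈ maximalIdeal R) (hx : IsSMulRegular R x) :
    ∃ rs' : List R, rs'.length = n ∧ (∀ r ∈ rs', r ∈ maximalIdeal R) ∧
      IsWeaklyRegular (R ⧸ Ideal.span {x})
        (rs'.map (algebraMap R (R ⧸ Ideal.span {x}))) := by
  obtain ⟨rs', h1, h2, h3⟩ := exists_isRegular_quotSMulTop hmem hreg hlen hxm hx
  refine ⟨rs', h1, h2, ?_⟩
  rw [isWeaklyRegular_map_algebraMap_iff]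
  have heq : x • (⊤ : Submodule R R) = Ideal.span {x} := by
    rw [← Submodule.ideal_span_singleton_smul, smul_eq_mul, Ideal.mul_top]
  exact ((Submodule.quotEquivOfEq _ _ heq).isWeaklyRegular_congr rs').1 h3.toIsWeaklyRegular

end Depth

section Generators

open RingTheory.Sequence Polynomial

universe u

lemma hilbertValue_succ (d : ℕ) (e : ℕ → ℤ) (n : ℕ) :
    hilbertValue (d + 1) e (n + 1) = hilbertValue (d + 1) e n + hilbertValue d e (n + 1) := by
  rw [hilbertValue, hilbertValue, Finset.sum_range_succ, Finset.sum_range_succ _ (d + 1),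
    hilbertValue]
  have h : ∀ i ∈ Finset.range (d + 1),
      (-1 : ℤ) ^ i * e i * ((n + 1 + (d + 1) - i).choose (d + 1 - i)) =
        (-1 : ℤ) ^ i * e i * ((n + (d + 1) - i).choose (d + 1 - i)) +
          (-1 : ℤ) ^ i * e i * ((n + 1 + d - i).choose (d - i)) := by
    intro i hi
    obtain ⟨k, hk⟩ := Nat.exists_eq_add_of_le (Finset.mem_range_succ_iff.1 hi)
    rw [show n + 1 + (d + 1) - i = n + k + 1 + 1 by omega, show d + 1 - i = k + 1 by omega,
      show n + (d + 1) - i = n + k + 1 by omega, show n + 1 + d - i = n + k + 1 by omega,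
      show d - i = k by omega, Nat.choose_succ_succ]
    push_cast
    ring
  rw [Finset.sum_congr rfl h, Finset.sum_add_distrib]
  simp only [Nat.sub_self, Nat.choose_zero_right]
  ring

lemma length_quotient_map_mk {R : Type*} [CommRing R] (A B : Ideal R) :
    Module.length (R ⧸ B) ((R ⧸ B) ⧸ A.map (Ideal.Quotient.mk B)) =
      Module.length R (R ⧸ (A ⊔ B)) := by
  rw [← Module.length_eq_of_surjective (S := R) (R := R ⧸ B) Ideal.Quotient.mk_surjective,
    sup_comm]
  exact (DoubleQuot.quotQuotEquivQuotSupₐ R B A).toLinearEquiv.length_eq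

lemma map_mk_maximalIdeal {R : Type*} [CommRing R] [IsLocalRing R] (A : Ideal R)
    [IsLocalRing (R ⧸ A)] :
    (maximalIdeal R).map (Ideal.Quotient.mk A) = maximalIdeal (R ⧸ A) :=
  map_maximalIdeal_of_surjective _ Ideal.Quotient.mk_surjective

lemma maximalIdeal_pow_le_map_mk {R : Type*} [CommRing R] [IsLocalRing R] {A I : Ideal R}
    [IsLocalRing (R ⧸ A)] {c : ℕ} (hc : maximalIdeal R ^ c ≤ I) :
    maximalIdeal (R ⧸ A) ^ c ≤ I.map (Ideal.Quotient.mk A) := by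
  rw [← map_mk_maximalIdeal, ← Ideal.map_pow]
  exact Ideal.map_mono hc

lemma length_quotient_maximalIdeal_mul_map_mk {R : Type*} [CommRing R] [IsLocalRing R]
    (A I : Ideal R) [IsLocalRing (R ⧸ A)] :
    Module.length (R ⧸ A) ((R ⧸ A) ⧸ (maximalIdeal (R ⧸ A) * I.map (Ideal.Quotient.mk A))) =
      Module.length R (R ⧸ (maximalIdeal R * I ⊔ A)) := by
  rw [← map_mk_maximalIdeal, ← Ideal.map_mul, length_quotient_map_mk]

lemma length_quotient_map_mk_pow {R : Type*} [CommRing R] (A I : Ideal R) (n : ℕ) :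
    Module.length (R ⧸ A) ((R ⧸ A) ⧸ I.map (Ideal.Quotient.mk A) ^ n) =
      Module.length R (R ⧸ (I ^ n ⊔ A)) := by
  rw [← Ideal.map_pow, length_quotient_map_mk]

lemma exists_span_range_coeff_eq {R : Type*} [CommRing R] [IsNoetherianRing R] (I : Ideal R) :
    ∃ x : R[X], Ideal.span (Set.range x.coeff) = I := by
  classical
  obtain ⟨k, a, rfl⟩ := Submodule.fg_iff_exists_fin_generating_family.1
    (IsNoetherian.noetherian I)
  refine ⟨ofFn k a, le_antisymm (Ideal.span_le.2 ?_) (Ideal.span_mono ?_)⟩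
  · rintro _ ⟨j, rfl⟩
    by_cases hj : j < k
    · rw [ofFn_coeff_eq_val_of_lt _ hj]
      exact Ideal.subset_span (Set.mem_range_self _)
    · rw [ofFn_coeff_eq_zero_of_ge _ (not_lt.1 hj)]
      exact zero_mem _
  · rintro _ ⟨j, rfl⟩
    exact ⟨j, ofFn_coeff_eq_val_of_lt a j.2⟩

/-- If the maximal ideal contains a weakly regular sequence of length `d` and `λ(R/Iⁿ⁺¹)` is
eventually the Hilbert polynomial with coefficients `e 0, …, e d`, then `λ(R/𝔪I) ≤ e 0 + d`. -/
theorem length_quotient_maximalIdeal_mul_le (d : ℕ) : ∀ {R : Type u} [CommRing R] [IsLocalRing R]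
    [IsNoetherianRing R] {I : Ideal R} {c : ℕ} {e : ℕ → ℤ} {rs : List R},
    maximalIdeal R ^ c ≤ I → I ≤ maximalIdeal R →
    (∀ r ∈ rs, r ∈ maximalIdeal R) → IsWeaklyRegular R rs → rs.length = d →
    (∃ N, ∀ n ≥ N, ∃ l : ℕ, Module.length R (R ⧸ I ^ (n + 1)) = l ∧ (l : ℤ) = hilbertValue d e n) →
    ∃ l : ℕ, Module.length R (R ⧸ (maximalIdeal R * I)) = l ∧ (l : ℤ) ≤ e 0 + d := by
  induction d with
  | zero =>
    intro R _ _ _ I c e rs _ hI _ _ _ ⟨N, hN⟩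
    obtain ⟨l, hl, hle⟩ := hN (N + 1) (by omega)
    have hle' : Module.length R (R ⧸ (maximalIdeal R * I)) ≤ l := by
      rw [← hl]
      refine length_quotient_anti ?_
      rw [pow_succ]
      refine Ideal.mul_mono_left ((Ideal.pow_le_self (Nat.succ_ne_zero N)).trans hI)
    obtain ⟨l', hl'⟩ := ENat.ne_top_iff_exists.1 (ne_top_of_le_ne_top (ENat.natCast_ne_top l) hle')
    refine ⟨l', hl'.symm, ?_⟩
    rw [← hl'] at hle'
    have h0 : hilbertValue 0 e (N + 1) = e 0 := by simp [hilbertValue]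
    have : l' ≤ l := by exact_mod_cast hle'
    push_cast
    omega
  | succ d ih =>
    intro R _ _ _ I c e rs hc hI hmem hreg hlen ⟨N, hN⟩
    obtain ⟨x, hx⟩ := exists_span_range_coeff_eq I
    have hreg' : ∀ a, (∀ i ∈ I, i * a = 0) → a = 0 := by
      match rs, hlen with
      | r :: rs', _ =>
        intro a ha
        have hr := ((isWeaklyRegular_cons_iff R r rs').1 hreg).1.pow c
        refine hr.right_eq_zero_of_smul ?_
        exact ha _ (hc (Ideal.pow_mem_pow (hmem r List.mem_cons_self) c))
    set S := NagataRing R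
    set IS := I.map (algebraMap R S) with hIS
    set z : S := algebraMap R[X] S x with hz
    have hzI : z ∈ IS := NagataRing.algebraMap_mem_map_iff.2 fun j =>
      hx ▸ Ideal.subset_span (Set.mem_range_self j)
    have hISm : IS ≤ maximalIdeal S := (Ideal.map_mono hI).trans (NagataRing.map_maximalIdeal R).le
    have hzm : z ∈ maximalIdeal S := hISm hzI
    have hzreg : IsSMulRegular S z := NagataRing.isSMulRegular_algebraMap x fun a ha =>
      hreg' a fun i hi => by
        rw [← hx] at hi
        refine (Ideal.span_le (I := Submodule.comap (LinearMap.mulRight R a) ⊥)).2 ?_ hi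
        rintro _ ⟨i, rfl⟩
        exact ha i
    obtain ⟨n₀, hn₀⟩ := exists_forall_mul_mem_pow_iff hzI hzreg
      (NagataRing.algebraMap_mul_mem_map_pow x hx)
    have hzS : Ideal.span {z} ≠ ⊤ := ne_top_of_le_ne_top (maximalIdeal.isMaximal S).ne_top
      ((Ideal.span_singleton_le_iff_mem _).2 hzm)
    have : Nontrivial (S ⧸ Ideal.span {z}) := Ideal.Quotient.nontrivial_iff.2 hzS
    have : IsLocalRing (S ⧸ Ideal.span {z}) :=
      IsLocalRing.of_surjective' (Ideal.Quotient.mk _) Ideal.Quotient.mk_surjective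
    obtain ⟨rs', hlen', hmem', hrs'⟩ := exists_isWeaklyRegular_quotient
      (rs := rs.map (algebraMap R S)) (n := d) (fun r hr => by
        obtain ⟨s, hs, rfl⟩ := List.mem_map.1 hr
        rw [← NagataRing.map_maximalIdeal]
        exact Ideal.mem_map_of_mem _ (hmem s hs)) hreg.of_flat (by simpa using hlen) hzm hzreg
    obtain ⟨l, hl, hle⟩ := ih (R := S ⧸ Ideal.span {z}) (c := c) (e := e)
      (I := IS.map (Ideal.Quotient.mk _)) (rs := rs'.map (Ideal.Quotient.mk _))
      (maximalIdeal_pow_le_map_mk (by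
        rw [← NagataRing.map_maximalIdeal, ← Ideal.map_pow]
        exact Ideal.map_mono hc))
      (by
        rw [← map_mk_maximalIdeal]
        exact Ideal.map_mono hISm)
      (fun r hr => by
        obtain ⟨s, hs, rfl⟩ := List.mem_map.1 hr
        rw [← map_mk_maximalIdeal]
        exact Ideal.mem_map_of_mem _ (hmem' s hs)) hrs' (by simpa using hlen')
      ⟨N + n₀ + 1, fun n hn => by
        obtain ⟨n, rfl⟩ := Nat.exists_eq_add_of_le' (le_trans (Nat.le_add_left 1 _) hn)
        obtain ⟨l₁, h₁, h₁'⟩ := hN (n + 1) (by omega)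
        obtain ⟨l₂, h₂, h₂'⟩ := hN n (by omega)
        have h := length_quotient_eq_add (hn₀ (n + 1) (by omega))
        rw [hIS, ← Ideal.map_pow, ← Ideal.map_pow, NagataRing.length_quotient_map,
          NagataRing.length_quotient_map, h₁, h₂, Ideal.map_pow, ← hIS] at h
        have hne : Module.length S (S ⧸ (IS ^ (n + 1 + 1) ⊔ Ideal.span {z})) ≠ ⊤ := fun htop => by
          rw [htop, add_top] at h
          exact ENat.natCast_ne_top _ h
        obtain ⟨l, hl⟩ := ENat.ne_top_iff_exists.1 hne
        rw [← hl] at h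
        refine ⟨l, (length_quotient_map_mk_pow _ IS _).trans hl.symm, ?_⟩
        have h' : l₁ = l₂ + l := by exact_mod_cast h
        have := hilbertValue_succ d e n
        omega⟩
    rw [length_quotient_maximalIdeal_mul_map_mk] at hl
    have h := length_quotient_le_add_one (A := maximalIdeal S * IS) (u := z) fun a ha => by
      rw [mul_comm z]
      exact Ideal.mul_mem_mul ha hzI
    rw [hl, ← NagataRing.map_maximalIdeal, ← Ideal.map_mul, NagataRing.length_quotient_map] at h
    obtain ⟨l', hl'⟩ := ENat.ne_top_iff_exists.1
      (ne_top_of_le_ne_top (ENat.natCast_ne_top (l + 1)) (by exact_mod_cast h))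
    refine ⟨l', hl'.symm, ?_⟩
    rw [← hl'] at h
    have : l' ≤ l + 1 := by exact_mod_cast h
    push_cast
    omega

lemma add_one_le_length_quotient_sq {R : Type*} [CommRing R] [IsLocalRing R] [IsNoetherianRing R]
    {d : ℕ} (hdim : ringKrullDim R = d) :
    ((d + 1 : ℕ) : ℕ∞) ≤ Module.length R (R ⧸ maximalIdeal R ^ 2) := by
  obtain ⟨t, ht, hle⟩ := exists_generators_card_add_length_le (maximalIdeal R)
  rw [length_quotient_maximalIdeal, ← sq] at hle
  refine le_trans ?_ hle
  have h := ringKrullDim_le_spanFinrank_maximalIdeal R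
  have h' := Submodule.spanFinrank_span_le_ncard_of_finite (R := R) (t.finite_toSet)
  rw [Set.ncard_coe_finset] at h'
  rw [hdim, ← ht] at h
  have : d ≤ t.card := (by exact_mod_cast h : d ≤ _).trans h'
  exact_mod_cast Nat.succ_le_succ this

end Generators

/-- **Vasconcelos (2003), Proposition 3.1**.  Let `(R,m)` be a Cohen-Macaulay Noetherian
local ring of dimension `d > 0` and `I` an `m`-primary ideal with `I ⊆ m²`.  Then
`ν(I) ≤ e₀(I) ≤ d!·λ(R/Ī)·e₀(R)`. -/
theorem generators_le_e0_le_lech_bound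
    {R : Type*} [CommRing R] [IsNoetherianRing R] [IsLocalRing R]
    (d : ℕ) (hd : 0 < d) (hdim : ringKrullDim R = d)
    (hCM : IsCohenMacaulayLocalRing R)
    (I : Ideal R) (hI : I.radical = maximalIdeal R)
    (hIm2 : I ≤ maximalIdeal R ^ 2)
    (e : ℕ → ℤ) (he : HasHilbertCoeffs I d e)
    (eR : ℕ → ℤ) (heR : HasHilbertCoeffs (maximalIdeal R) d eR)
    (lbar : ℕ)
    (hlbar : moduleLength R (R ⧸ idealIntegralClosure I) = (lbar : WithBot ℕ∞)) :
    (∃ s : Finset R, Ideal.span (s : Set R) = I ∧ (s.card : ℤ) ≤ e 0) ∧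
      e 0 ≤ (d.factorial : ℤ) * lbar * eR 0 := by
  obtain ⟨c, hc⟩ := Ideal.exists_pow_le_of_le_radical_of_fg hI.ge (IsNoetherian.noetherian _)
  refine ⟨?_, ?_⟩
  · obtain ⟨rs, hmem, hreg, hlen⟩ := hCM
    have hlen' : rs.length = d := by
      rw [hdim] at hlen
      exact_mod_cast hlen
    obtain ⟨l, hl, hle⟩ := length_quotient_maximalIdeal_mul_le d hc
      (hIm2.trans (Ideal.pow_le_self two_ne_zero)) hmem hreg.toIsWeaklyRegular hlen'
      he.exists_length_eq
    obtain ⟨s, hs, hcard⟩ := exists_generators_card_add_length_le I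
    refine ⟨s, hs, ?_⟩
    have h := (add_le_add_right ((add_one_le_length_quotient_sq hdim).trans
      (length_quotient_anti hIm2)) (s.card : ℕ∞)).trans hcard
    rw [hl] at h
    have h' : s.card + (d + 1) ≤ l := by exact_mod_cast h
    omega
  · refine coeff_zero_le_factorial_mul_length_mul_coeff_zero hc he heR ?_
    rw [moduleLength, ← Module.coe_length] at hlbar
    exact_mod_cast hlbar
end

section
/- Let (R,m) be a Cohen-Macaulay Noetherian local ring of dimension d > 0 with infinite residue field and let I be an m-primary ideal. Then f_0(I) ≤ e_1(I) − e_0(I) + λ(R/I) + ν(I) − d + 1 ≤ e_1(I) + 1, where f_0(I) is the multiplicity of the special fiber ring of I and ν(I) is the minimal number of generators of I. -/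
open Finset IsLocalRing

/-- `f0` is the multiplicity of the special fiber ring `F(I) = ⊕ Iⁿ/mIⁿ` of `I`:
the Hilbert function `n ↦ ν(Iⁿ) = λ(Iⁿ/mIⁿ)` eventually agrees with a polynomial of
degree `d-1` with leading term `f0 · n^(d-1)/(d-1)!`, written in the binomial basis. -/
def HasFiberMultiplicity {R : Type*} [CommRing R] [IsLocalRing R]
    (I : Ideal R) (d : ℕ) (f0 : ℤ) : Prop :=
  ∃ (c : ℕ → ℤ) (N : ℕ), c 0 = f0 ∧ ∀ n ≥ N, ∃ l : ℕ,
    moduleLength R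
      (↥(I ^ n) ⧸ Submodule.comap (I ^ n : Ideal R).subtype (maximalIdeal R * I ^ n)) =
      (l : WithBot ℕ∞) ∧
    (l : ℤ) = ∑ i ∈ Finset.range d, c i * ((n + (d - 1) - i).choose (d - 1 - i))

section Colength

variable {R : Type*} [CommRing R]

/-- The length of the quotient of a ring by an ideal. -/
noncomputable def Ideal.colength (A : Ideal R) : ℕ∞ :=
  Module.length R (R ⧸ A)

theorem moduleLength_eq_coe_iff {M : Type*} [AddCommGroup M] [Module R M] {l : ℕ} :
    moduleLength R M = (l : WithBot ℕ∞) ↔ Module.length R M = l := by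
  rw [moduleLength, ← Module.coe_length]
  norm_cast

theorem Ideal.colength_anti {A B : Ideal R} (h : A ≤ B) : B.colength ≤ A.colength :=
  Module.length_le_of_surjective (Submodule.factor h) (Submodule.factor_surjective h)

theorem Ideal.colength_eq_length_add {A B : Ideal R} (h : B ≤ A) :
    B.colength = Module.length R (A ⧸ Submodule.comap A.subtype B) + A.colength := by
  let f : (A ⧸ Submodule.comap A.subtype B) →ₗ[R] R ⧸ B :=
    Submodule.mapQ _ B A.subtype le_rfl
  refine Module.length_eq_add_of_exact f (Submodule.factor h) ?_
    (Submodule.factor_surjective h) ?_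
  · rw [← LinearMap.ker_eq_bot, Submodule.ker_mapQ, Submodule.mkQ_map_self]
  · intro y
    obtain ⟨y, rfl⟩ := Submodule.Quotient.mk_surjective _ y
    constructor
    · intro hy
      have hy' : y ∈ A := by
        rw [← Submodule.Quotient.mk_eq_zero A]
        exact hy
      exact ⟨Submodule.Quotient.mk ⟨y, hy'⟩, rfl⟩
    · rintro ⟨z, hz⟩
      obtain ⟨z, rfl⟩ := Submodule.Quotient.mk_surjective _ z
      rw [← hz]
      exact (Submodule.Quotient.mk_eq_zero A).mpr z.2

/-- Adding one generator `x` to `B` lowers the colength by the colength of `B : x`. -/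
theorem Ideal.colength_eq_add_colength_colon {B Q : Ideal R} {x : R}
    (hQ : ∀ r, r ∈ Q ↔ r * x ∈ B) :
    B.colength = Q.colength + (B ⊔ Ideal.span {x}).colength := by
  let g : R →ₗ[R] R ⧸ B := B.mkQ ∘ₗ LinearMap.toSpanSingleton R R x
  have hg : ∀ r, g r = Submodule.Quotient.mk (r * x) := fun r ↦ by simp [g]
  have hker : LinearMap.ker g = Q := by
    ext r
    rw [LinearMap.mem_ker, hg, Submodule.Quotient.mk_eq_zero, hQ]
  refine Module.length_eq_add_of_exact (Submodule.liftQ Q g hker.ge)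
    (Submodule.factor (le_sup_left : B ≤ B ⊔ Ideal.span {x})) ?_
    (Submodule.factor_surjective _) ?_
  · rw [← LinearMap.ker_eq_bot, Submodule.ker_liftQ, hker, Submodule.mkQ_map_self]
  · intro y
    obtain ⟨y, rfl⟩ := Submodule.Quotient.mk_surjective _ y
    constructor
    · intro hy
      have hy' : y ∈ B ⊔ Ideal.span {x} := by
        rw [← Submodule.Quotient.mk_eq_zero (B ⊔ Ideal.span {x})]
        exact hy
      obtain ⟨b, hb, z, hz, rfl⟩ := Submodule.mem_sup.mp hy'
      obtain ⟨c, rfl⟩ := Ideal.mem_span_singleton'.mp hz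
      refine ⟨Submodule.Quotient.mk c, ?_⟩
      change g c = _
      rw [hg, Submodule.Quotient.eq]
      simpa using hb
    · rintro ⟨z, hz⟩
      obtain ⟨z, rfl⟩ := Submodule.Quotient.mk_surjective _ z
      rw [← hz]
      change (Submodule.factor _) (g z) = 0
      rw [hg]
      refine (Submodule.Quotient.mk_eq_zero _).mpr ?_
      exact Submodule.mem_sup_right (Ideal.mul_mem_left _ _ (Ideal.mem_span_singleton_self x))

/-- The colength grows by at most `k • λ(R ⧸ Q)` when `k` generators killed by `Q`
modulo `B` are removed. -/
theorem Ideal.colength_le_add_length_mul {Q : Ideal R} (xs : List R) {B : Ideal R}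
    (h : ∀ x ∈ xs, ∀ q ∈ Q, q * x ∈ B) :
    B.colength ≤ (B ⊔ Ideal.ofList xs).colength + xs.length * Q.colength := by
  induction xs generalizing B with
  | nil => simp
  | cons x xs ih =>
    let C : Ideal R := Submodule.comap (LinearMap.toSpanSingleton R R x) B
    have hC : ∀ r, r ∈ C ↔ r * x ∈ B := fun r ↦ by simp [C]
    have hQC : Q ≤ C := fun q hq ↦ (hC q).mpr (h x List.mem_cons_self q hq)
    have key := ih (B := B ⊔ Ideal.span {x})
      fun y hy q hq ↦ Submodule.mem_sup_left (h y (List.mem_cons_of_mem _ hy) q hq)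
    rw [Ideal.ofList_cons, ← sup_assoc]
    calc B.colength = C.colength + (B ⊔ Ideal.span {x}).colength :=
          Ideal.colength_eq_add_colength_colon hC
      _ ≤ Q.colength + ((B ⊔ Ideal.span {x} ⊔ Ideal.ofList xs).colength +
            xs.length * Q.colength) := add_le_add (Ideal.colength_anti hQC) key
      _ = _ := by rw [List.length_cons]; push_cast; ring

theorem Ideal.one_le_colength {A : Ideal R} (h : A ≠ ⊤) : 1 ≤ A.colength := by
  have : Nontrivial (R ⧸ A) := Ideal.Quotient.nontrivial_iff.mpr h
  exact Order.one_le_iff_pos.mpr Module.length_pos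

/-- An ideal `I` is generated over `J` by at most `λ(R ⧸ J) - λ(R ⧸ I)` elements. -/
theorem Ideal.exists_sup_ofList_eq {I : Ideal R} (hI : I.colength ≠ ⊤) (k : ℕ) {J : Ideal R}
    (hJI : J ≤ I) (hk : J.colength ≤ I.colength + k) :
    ∃ t : List R, t.length ≤ k ∧ J ⊔ Ideal.ofList t = I := by
  induction k generalizing J with
  | zero =>
    refine ⟨[], le_rfl, ?_⟩
    rw [Ideal.ofList_nil, sup_bot_eq]
    refine le_antisymm hJI fun x hx ↦ ?_
    by_contra hxJ
    let C : Ideal R := Submodule.comap (LinearMap.toSpanSingleton R R x) J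
    have hC : ∀ r, r ∈ C ↔ r * x ∈ J := fun r ↦ by simp [C]
    have h1 : 1 ≤ C.colength := Ideal.one_le_colength fun h ↦ hxJ <| by
      simpa using (hC 1).mp (h ▸ Submodule.mem_top)
    have h2 : I.colength ≤ (J ⊔ Ideal.span {x}).colength :=
      Ideal.colength_anti (sup_le hJI ((Ideal.span_singleton_le_iff_mem I).mpr hx))
    rw [Ideal.colength_eq_add_colength_colon hC] at hk
    have h3 := (add_le_add h1 h2).trans hk
    lift I.colength to ℕ using hI with l
    norm_cast at h3
    omega
  | succ k ih =>
    by_cases hIJ : I ≤ J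
    · exact ⟨[], by simp, by simpa using le_antisymm hJI hIJ⟩
    obtain ⟨x, hx, hxJ⟩ := Set.not_subset.mp hIJ
    let C : Ideal R := Submodule.comap (LinearMap.toSpanSingleton R R x) J
    have hC : ∀ r, r ∈ C ↔ r * x ∈ J := fun r ↦ by simp [C]
    have h1 : 1 ≤ C.colength := Ideal.one_le_colength fun h ↦ hxJ <| by
      simpa using (hC 1).mp (h ▸ Submodule.mem_top)
    obtain ⟨t, ht, hJt⟩ := ih (J := J ⊔ Ideal.span {x})
      (sup_le hJI ((Ideal.span_singleton_le_iff_mem I).mpr hx)) (by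
        rw [Ideal.colength_eq_add_colength_colon hC] at hk
        have h3 := (add_le_add_left h1 _).trans hk
        rw [add_comm] at h3
        push_cast at h3
        rw [← add_assoc] at h3
        exact (ENat.add_le_add_iff_right (by simp)).mp h3)
    exact ⟨x :: t, by simpa using ht, by rw [Ideal.ofList_cons, ← sup_assoc, hJt]⟩

theorem Ideal.exists_ofList_eq_mul (s t : List R) :
    ∃ u : List R, u.length = s.length * t.length ∧
      Ideal.ofList u = Ideal.ofList s * Ideal.ofList t := by
  induction s with
  | nil => exact ⟨[], by simp⟩
  | cons x s ih =>
    obtain ⟨u, hu, hu'⟩ := ih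
    refine ⟨t.map (x * ·) ++ u, by simp [hu]; ring, ?_⟩
    rw [Ideal.ofList_append, Ideal.ofList_cons, Ideal.sup_mul, hu']
    congr 1
    rw [Ideal.ofList, Ideal.ofList, Ideal.span_mul_span']
    congr 1
    ext y
    simp [Set.singleton_mul]

/-- The `n`-th power of an ideal with `d` generators is generated by as many elements as
there are monomials of degree `n` in `d` variables. -/
theorem Ideal.exists_ofList_eq_pow (s : List R) (n : ℕ) :
    ∃ u : List R, u.length = Nat.multichoose s.length n ∧
      Ideal.ofList u = Ideal.ofList s ^ n := by
  induction s generalizing n with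
  | nil =>
    cases n with
    | zero => exact ⟨[1], by simp, by simp⟩
    | succ n => exact ⟨[], by simp, by simp [Submodule.bot_pow]⟩
  | cons x s ih =>
    induction n with
    | zero => exact ⟨[1], by simp, by simp⟩
    | succ n ihn =>
      obtain ⟨u, hu, hu'⟩ := ih (n + 1)
      obtain ⟨v, hv, hv'⟩ := ihn
      obtain ⟨w, hw, hw'⟩ := Ideal.exists_ofList_eq_mul [x] v
      refine ⟨u ++ w, ?_, ?_⟩
      · rw [List.length_append, List.length_cons, Nat.multichoose_succ_succ, hu, hw, hv]
        simp
      · rw [Ideal.ofList_append, hu', hw', hv', Ideal.ofList_singleton, Ideal.ofList_cons]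
        generalize Ideal.span {x} = X
        generalize Ideal.ofList s = S
        refine le_antisymm (sup_le (Ideal.pow_right_mono le_sup_right _) ?_) ?_
        · rw [pow_succ']
          exact Ideal.mul_mono_left le_sup_left
        · clear hu hu' hv hv' hw hw' ih
          induction n with
          | zero => simp [sup_comm]
          | succ n ihn =>
            calc (X ⊔ S) ^ (n + 1 + 1) = X * (X ⊔ S) ^ (n + 1) ⊔ S * (X ⊔ S) ^ (n + 1) := by
                  rw [pow_succ' _ (n + 1), Ideal.sup_mul]
              _ ≤ X * (X ⊔ S) ^ (n + 1) ⊔ S * (S ^ (n + 1) ⊔ X * (X ⊔ S) ^ n) :=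
                  sup_le_sup_left (Ideal.mul_mono_right ihn) _
              _ = X * (X ⊔ S) ^ (n + 1) ⊔ (S ^ (n + 1 + 1) ⊔ X * (S * (X ⊔ S) ^ n)) := by
                  rw [Ideal.mul_sup, ← pow_succ' S (n + 1), mul_left_comm]
              _ ≤ S ^ (n + 1 + 1) ⊔ X * (X ⊔ S) ^ (n + 1) := by
                  refine sup_le le_sup_right (sup_le_sup_left ?_ _)
                  rw [pow_succ' _ n]
                  exact Ideal.mul_mono_right (Ideal.mul_mono_left le_sup_right)

end Colength

section Avoidance

variable {R : Type*} [CommRing R]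

/-- Over a local ring with infinite residue field, a finitely generated ideal is not covered
by finitely many ideals none of which contains it. -/
theorem Ideal.exists_mem_forall_notMem [IsLocalRing R] [Infinite (IsLocalRing.ResidueField R)]
    {I : Ideal R} (hI : I.FG) (s : Finset (Ideal R)) (hs : ∀ N ∈ s, ¬ I ≤ N) :
    ∃ a ∈ I, ∀ N ∈ s, a ∉ N := by
  by_contra! hcon
  have hcov : ⋃ N ∈ s, (Submodule.comap I.subtype N : Set I) = Set.univ := by
    refine Set.eq_univ_of_forall fun a ↦ ?_
    obtain ⟨N, hN, ha⟩ := hcon a a.2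
    exact Set.mem_biUnion (Finset.mem_coe.mpr hN) ha
  obtain ⟨N, hN, hfin⟩ := Submodule.exists_finiteIndex_of_cover hcov
  have : Finite (I ⧸ Submodule.comap I.subtype N) := AddSubgroup.finite_quotient_of_finiteIndex
  have hne : ¬ I ≤ N ⊓ I ⊔ maximalIdeal R * I := fun h ↦ hs N hN <|
    (Submodule.le_of_le_smul_of_le_jacobson_bot hI (maximalIdeal_le_jacobson _) h).trans inf_le_left
  obtain ⟨v, hvI, hv⟩ := Set.not_subset.mp hne
  let K : Ideal R := N ⊓ I ⊔ maximalIdeal R * I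
  have hK : ∀ r, r * v ∈ K → r ∈ maximalIdeal R := fun r hr ↦ by
    by_contra h
    exact hv ((Ideal.unit_mul_mem_iff_mem K (notMem_maximalIdeal.mp h)).mp hr)
  refine not_injective_infinite_finite
    (fun c : IsLocalRing.ResidueField R ↦ (Submodule.Quotient.mk
      (Function.surjInv residue_surjective c • ⟨v, hvI⟩) : I ⧸ Submodule.comap I.subtype N)) ?_
  intro b c hbc
  have h1 := (Submodule.Quotient.eq _).mp hbc
  rw [← sub_smul, Submodule.mem_comap] at h1
  have h2 : Function.surjInv residue_surjective b - Function.surjInv residue_surjective c ∈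
      maximalIdeal R := hK _ (Submodule.mem_sup_left ⟨h1, I.mul_mem_left _ hvI⟩)
  rw [← residue_eq_zero_iff, map_sub, Function.surjInv_eq residue_surjective,
    Function.surjInv_eq residue_surjective, sub_eq_zero] at h2
  exact h2

end Avoidance

section Superficial

variable {R : Type*} [CommRing R] {I : Ideal R}

open Polynomial

/-- The element `r tⁿ` of the Rees algebra of `I`, for `r ∈ Iⁿ`. -/
noncomputable def reesMonomial {n : ℕ} {r : R} (hr : r ∈ I ^ n) : reesAlgebra I :=
  ⟨monomial n r, reesAlgebra.monomial_mem.mpr hr⟩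

theorem reesMonomial_mul {m n : ℕ} {r s : R} (hr : r ∈ I ^ m) (hs : s ∈ I ^ n)
    (hrs : r * s ∈ I ^ (m + n)) :
    reesMonomial hr * reesMonomial hs = reesMonomial hrs :=
  Subtype.ext (monomial_mul_monomial m n r s)

theorem reesMonomial_add {n : ℕ} {r s : R} (hr : r ∈ I ^ n) (hs : s ∈ I ^ n) :
    reesMonomial (add_mem hr hs) = reesMonomial hr + reesMonomial hs :=
  Subtype.ext ((monomial n).map_add r s)

theorem coeff_mem_of_mem_map_algebraMap_reesAlgebra {f : reesAlgebra I}
    (hf : f ∈ I.map (algebraMap R (reesAlgebra I))) (n : ℕ) :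
    (f : R[X]).coeff n ∈ I ^ (n + 1) := by
  induction hf using Submodule.span_induction generalizing n with
  | mem x hx =>
    obtain ⟨r, hr, rfl⟩ := hx
    change (C r).coeff n ∈ _
    rw [coeff_C]
    split_ifs with h
    · simpa [h] using hr
    · exact zero_mem _
  | zero => simp
  | add x y _ _ hx hy => simpa using add_mem (hx n) (hy n)
  | smul a x _ hx =>
    rw [smul_eq_mul, Subalgebra.coe_mul, coeff_mul]
    refine sum_mem fun p hp ↦ ?_
    rw [← HasAntidiagonal.mem_antidiagonal.mp hp, add_assoc, pow_add]
    exact Ideal.mul_mem_mul (a.2 p.1) (hx p.2)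

theorem reesMonomial_mem_map_algebraMap {n : ℕ} {r : R} (hr : r ∈ I ^ n)
    (hr' : r ∈ I ^ (n + 1)) :
    reesMonomial hr ∈ I.map (algebraMap R (reesAlgebra I)) := by
  suffices ∃ h : r ∈ I ^ n, reesMonomial h ∈ I.map (algebraMap R (reesAlgebra I)) from this.2
  rw [pow_succ'] at hr'
  induction hr' using Submodule.mul_induction_on' with
  | mem_mul_mem x hx y hy =>
    refine ⟨Ideal.mul_mem_left _ _ hy, ?_⟩
    have : reesMonomial (Ideal.mul_mem_left _ x hy) =
        algebraMap R (reesAlgebra I) x * reesMonomial hy :=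
      Subtype.ext (C_mul_monomial (a := x) (b := y) (n := n)).symm
    rw [this]
    exact Ideal.mul_mem_right _ _ (Ideal.mem_map_of_mem _ hx)
  | add x _ y _ hx hy =>
    obtain ⟨hx, hx'⟩ := hx (Ideal.pow_le_pow_right n.le_succ (by rwa [pow_succ']))
    obtain ⟨hy, hy'⟩ := hy (Ideal.pow_le_pow_right n.le_succ (by rwa [pow_succ']))
    refine ⟨add_mem hx hy, ?_⟩
    rw [reesMonomial_add hx hy]
    exact add_mem hx' hy'

/-- The embedding of `I` in degree one of its Rees algebra. -/
noncomputable def reesDegreeOne (I : Ideal R) : I →ₗ[R] reesAlgebra I where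
  toFun a := reesMonomial (n := 1) (r := a) ((pow_one I).symm ▸ a.2)
  map_add' x y := Subtype.ext ((monomial 1).map_add (x : R) (y : R))
  map_smul' c x := Subtype.ext ((monomial 1).map_smul c (x : R))

theorem reesMonomial_mul_reesDegreeOne {n : ℕ} {r a : R} (hr : r ∈ I ^ n) (ha : a ∈ I)
    (hra : r * a ∈ I ^ (n + 1)) :
    reesMonomial hr * reesDegreeOne I ⟨a, ha⟩ = reesMonomial hra :=
  Subtype.ext (monomial_mul_monomial n 1 r a)

theorem reesMonomial_mem_span_range_pow {n : ℕ} {r : R} (hr : r ∈ I ^ n) :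
    reesMonomial hr ∈ Ideal.span (Set.range (reesDegreeOne I)) ^ n := by
  induction n generalizing r with
  | zero => simp
  | succ n ih =>
    suffices ∃ h : r ∈ I ^ (n + 1),
      reesMonomial h ∈ Ideal.span (Set.range (reesDegreeOne I)) ^ (n + 1) from this.2
    have hr' := hr
    rw [pow_succ] at hr'
    clear hr
    induction hr' using Submodule.mul_induction_on' with
    | mem_mul_mem x hx y hy =>
      have hxy : x * y ∈ I ^ (n + 1) := by
        rw [pow_succ]
        exact Ideal.mul_mem_mul hx hy
      refine ⟨hxy, ?_⟩
      have : reesMonomial hxy = reesMonomial hx * reesDegreeOne I ⟨y, hy⟩ :=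
        (reesMonomial_mul_reesDegreeOne hx hy hxy).symm
      rw [this, pow_succ]
      exact Ideal.mul_mem_mul (ih hx) (Ideal.subset_span ⟨_, rfl⟩)
    | add x _ y _ hx hy =>
      obtain ⟨hx, hx'⟩ := hx
      obtain ⟨hy, hy'⟩ := hy
      refine ⟨add_mem hx hy, ?_⟩
      rw [reesMonomial_add hx hy]
      exact add_mem hx' hy'

/-- Elements of `I` outside finitely many ideals, none containing `I`, act injectively
on the associated graded ring of `I` in large degrees. -/
theorem Ideal.exists_finset_forall_superficial [IsNoetherianRing R] (I : Ideal R) :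
    ∃ s : Finset (Ideal R), (∀ N ∈ s, ¬ I ≤ N) ∧ ∃ c : ℕ, ∀ a ∈ I, (∀ N ∈ s, a ∉ N) →
      ∀ n ≥ c, ∀ r ∈ I ^ n, r * a ∈ I ^ (n + 2) → r ∈ I ^ (n + 1) := by
  classical
  obtain ⟨t, ht, hprim⟩ := Submodule.isLasker (reesAlgebra I) (reesAlgebra I)
    (I.map (algebraMap R (reesAlgebra I)))
  let N : Ideal (reesAlgebra I) → Ideal R := fun Q ↦
    (((Ideal.radical Q).restrictScalars R).comap (reesDegreeOne I)).map I.subtype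
  have hN : ∀ Q a (ha : a ∈ I), a ∈ N Q ↔ reesDegreeOne I ⟨a, ha⟩ ∈ (Ideal.radical Q) := by
    intro Q a ha
    constructor
    · rintro ⟨b, hb, rfl⟩
      exact hb
    · exact fun h ↦ ⟨⟨a, ha⟩, h, rfl⟩
  have hpow : ∀ Q, I ≤ N Q → ∃ k, Ideal.span (Set.range (reesDegreeOne I)) ^ k ≤ Q := by
    intro Q hQ
    refine Ideal.exists_pow_le_of_le_radical_of_fg (Ideal.span_le.mpr ?_)
      (IsNoetherian.noetherian _)
    rintro _ ⟨a, rfl⟩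
    exact (hN Q a a.2).mp (hQ a.2)
  choose! k hk using hpow
  refine ⟨(t.image N).filter (¬ I ≤ ·), by simp, t.sup k, fun a ha haN n hn r hr hra ↦ ?_⟩
  suffices reesMonomial hr ∈ I.map (algebraMap R (reesAlgebra I)) by
    simpa [reesMonomial] using coeff_mem_of_mem_map_algebraMap_reesAlgebra this n
  rw [← ht, Submodule.mem_finsetInf]
  intro Q hQ
  by_cases hIQ : I ≤ N Q
  · exact hk Q hIQ (Ideal.pow_le_pow_right ((Finset.le_sup hQ).trans hn)
      (reesMonomial_mem_span_range_pow hr))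
  · have haQ : reesDegreeOne I ⟨a, ha⟩ ∉ (Ideal.radical Q) := fun h ↦
      haN (N Q) (by simpa using ⟨⟨Q, hQ, rfl⟩, hIQ⟩) ((hN Q a ha).mpr h)
    refine ((Ideal.isPrimary_iff.mp (hprim hQ)).2 ?_).resolve_right haQ
    have hra' : r * a ∈ I ^ (n + 1) := Ideal.pow_le_pow_right (by omega) hra
    have hmem := reesMonomial_mem_map_algebraMap hra' hra
    rw [← ht] at hmem
    have : reesMonomial hr * reesDegreeOne I ⟨a, ha⟩ = reesMonomial hra' :=
      reesMonomial_mul_reesDegreeOne hr ha hra'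
    rw [this]
    exact Finset.inf_le (f := id) hQ hmem

/-- A regular element that is superficial for `I` satisfies `Iⁿ⁺¹ : a = Iⁿ` for large `n`. -/
theorem Ideal.mul_mem_pow_succ_iff_of_superficial [IsNoetherianRing R] {a : R} (ha : a ∈ I)
    (hreg : IsSMulRegular R a) {c : ℕ}
    (hc : ∀ n ≥ c, ∀ r ∈ I ^ n, r * a ∈ I ^ (n + 2) → r ∈ I ^ (n + 1)) :
    ∃ n₀, ∀ n ≥ n₀, ∀ r, r ∈ I ^ n ↔ r * a ∈ I ^ (n + 1) := by
  obtain ⟨k, hk⟩ := I.exists_pow_inf_eq_pow_smul (Ideal.span {a} : Ideal R)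
  refine ⟨c + k, fun n hn r ↦ ⟨fun hr ↦ ?_, fun hr ↦ ?_⟩⟩
  · rw [pow_succ]
    exact Ideal.mul_mem_mul hr ha
  · have hrk : r ∈ I ^ (n + 1 - k) := by
      have h1 : r * a ∈ I ^ (n + 1) • (⊤ : Ideal R) ⊓ Ideal.span {a} :=
        ⟨by simpa using hr, Ideal.mul_mem_left _ _ (Ideal.mem_span_singleton_self a)⟩
      rw [hk (n + 1) (by omega)] at h1
      have h2 : r * a ∈ I ^ (n + 1 - k) * Ideal.span {a} :=
        Ideal.mul_mono_right inf_le_right h1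
      obtain ⟨z, hz, hza⟩ := Ideal.mem_mul_span_singleton.mp h2
      have : z = r := hreg (by simpa [mul_comm] using hza)
      exact this ▸ hz
    have key : ∀ j, c ≤ j → j ≤ n → r ∈ I ^ j := by
      intro j hj
      induction j, hj using Nat.le_induction with
      | base => exact fun _ ↦ Ideal.pow_le_pow_right (by omega) hrk
      | succ j hj ih =>
        exact fun hjn ↦ hc j hj r (ih (by omega)) (Ideal.pow_le_pow_right (by omega) hr)
    exact key n (by omega) le_rfl

end Superficial

section HilbertCoeffs

variable {R : Type*} [CommRing R]

theorem hasHilbertCoeffs_iff {I : Ideal R} {d : ℕ} {e : ℕ → ℤ} :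
    HasHilbertCoeffs I d e ↔ ∃ N : ℕ, ∀ n ≥ N, ∃ l : ℕ, (I ^ (n + 1)).colength = l ∧
      (l : ℤ) = ∑ i ∈ Finset.range (d + 1), (-1 : ℤ) ^ i * e i * ((n + d - i).choose (d - i)) := by
  simp only [HasHilbertCoeffs, moduleLength_eq_coe_iff, Ideal.colength]

theorem Ideal.colength_map_quotientMk (A B : Ideal R) :
    (A.map (Ideal.Quotient.mk B)).colength = (B ⊔ A).colength := by
  rw [Ideal.colength, Ideal.colength,
    ← Module.length_eq_of_surjective (S := R) (R := R ⧸ B) Ideal.Quotient.mk_surjective]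
  exact (DoubleQuot.quotQuotEquivQuotSupₐ R B A).toLinearEquiv.length_eq

theorem sum_choose_sub_sum_choose (d n : ℕ) (e : ℕ → ℤ) :
    ∑ i ∈ Finset.range (d + 1 + 1),
        (-1 : ℤ) ^ i * e i * ((n + 1 + (d + 1) - i).choose (d + 1 - i)) -
      ∑ i ∈ Finset.range (d + 1 + 1),
        (-1 : ℤ) ^ i * e i * ((n + (d + 1) - i).choose (d + 1 - i)) =
      ∑ i ∈ Finset.range (d + 1), (-1 : ℤ) ^ i * e i * ((n + 1 + d - i).choose (d - i)) := by
  rw [Finset.sum_range_succ, Finset.sum_range_succ _ (d + 1), Nat.sub_self, Nat.choose_zero_right,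
    Nat.choose_zero_right, add_sub_add_right_eq_sub, ← Finset.sum_sub_distrib]
  refine Finset.sum_congr rfl fun i hi ↦ ?_
  obtain ⟨j, rfl⟩ := Nat.exists_eq_add_of_le (Nat.lt_succ_iff.mp (Finset.mem_range.mp hi))
  rw [show n + 1 + (i + j + 1) - i = (n + 1 + j) + 1 by omega,
    show n + (i + j + 1) - i = n + 1 + j by omega, show i + j + 1 - i = j + 1 by omega,
    show n + 1 + (i + j) - i = n + 1 + j by omega, show i + j - i = j by omega,
    Nat.choose_succ_succ']
  push_cast
  ring

/-- Hilbert coefficients restrict modulo an element `a` with `Iⁿ⁺¹ : a = Iⁿ` for large `n`. -/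
theorem HasHilbertCoeffs.map_quotientMk {I : Ideal R} {d : ℕ} {e : ℕ → ℤ}
    (he : HasHilbertCoeffs I (d + 1) e) {a : R} {n₀ : ℕ}
    (ha : ∀ n ≥ n₀, ∀ r, r ∈ I ^ n ↔ r * a ∈ I ^ (n + 1)) :
    HasHilbertCoeffs (I.map (Ideal.Quotient.mk (Ideal.span {a}))) d e := by
  rw [hasHilbertCoeffs_iff] at he ⊢
  obtain ⟨N, hN⟩ := he
  refine ⟨N + n₀ + 1, fun n hn ↦ ?_⟩
  obtain ⟨n, rfl⟩ : ∃ m, n = m + 1 := ⟨n - 1, by omega⟩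
  obtain ⟨l₁, h₁, h₁'⟩ := hN (n + 1) (by omega)
  obtain ⟨l₀, h₀, h₀'⟩ := hN n (by omega)
  have h := Ideal.colength_eq_add_colength_colon (ha (n + 1) (by omega))
  rw [← Ideal.map_pow, Ideal.colength_map_quotientMk, sup_comm]
  rw [h₁, h₀] at h
  have hfin : (I ^ (n + 1 + 1) ⊔ Ideal.span {a}).colength ≠ ⊤ := by
    intro h'
    rw [h', add_top] at h
    exact ENat.natCast_ne_top _ h
  lift (I ^ (n + 1 + 1) ⊔ Ideal.span {a}).colength to ℕ using hfin with l hl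
  refine ⟨l, rfl, ?_⟩
  rw [← sum_choose_sub_sum_choose, ← h₁', ← h₀']
  norm_cast at h
  omega

end HilbertCoeffs

section Parameters

theorem Ideal.exists_ofList_cons_eq {R : Type*} [CommRing R] [IsLocalRing R] (u : List R) {a : R}
    (ha : a ∈ Ideal.ofList u) (ha' : a ∉ maximalIdeal R * Ideal.ofList u) :
    ∃ v : List R, v.length + 1 = u.length ∧ Ideal.ofList (a :: v) = Ideal.ofList u := by
  induction u generalizing a with
  | nil =>
    rw [Ideal.ofList_nil] at ha
    exact absurd (by rw [(Submodule.mem_bot R).mp ha]; exact zero_mem _) ha'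
  | cons x u ih =>
    rw [Ideal.ofList_cons] at ha
    obtain ⟨z, hz, y, hy, rfl⟩ := Submodule.mem_sup.mp ha
    obtain ⟨c, rfl⟩ := Ideal.mem_span_singleton'.mp hz
    by_cases hc : c ∈ maximalIdeal R
    · have hy' : y ∉ maximalIdeal R * Ideal.ofList u := fun h ↦ ha' <| by
        rw [Ideal.ofList_cons]
        exact add_mem (Ideal.mul_mem_mul hc (Submodule.mem_sup_left
          (Ideal.mem_span_singleton_self x))) (Ideal.mul_mono_right le_sup_right h)
      obtain ⟨v, hv, hyv⟩ := ih hy hy'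
      refine ⟨x :: v, by simp [hv], ?_⟩
      rw [Ideal.ofList_cons x u, ← hyv]
      simp only [Ideal.ofList_cons]
      refine le_antisymm (sup_le ?_ ?_) (sup_le ?_ (sup_le ?_ ?_))
      · rw [Ideal.span_singleton_le_iff_mem]
        exact add_mem (Submodule.mem_sup_left hz) (Submodule.mem_sup_right
          (Submodule.mem_sup_left (Ideal.mem_span_singleton_self y)))
      · exact sup_le_sup_left le_sup_right _
      · exact le_sup_left.trans le_sup_right
      · rw [Ideal.span_singleton_le_iff_mem]
        have h1 : c * x + y ∈ Ideal.span {c * x + y} ⊔ (Ideal.span {x} ⊔ Ideal.ofList v) :=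
          Submodule.mem_sup_left (Ideal.mem_span_singleton_self _)
        have h2 : c * x ∈ Ideal.span {c * x + y} ⊔ (Ideal.span {x} ⊔ Ideal.ofList v) :=
          Submodule.mem_sup_right (Submodule.mem_sup_left hz)
        simpa using sub_mem h1 h2
      · exact le_sup_right.trans le_sup_right
    · refine ⟨u, rfl, ?_⟩
      have hcu := notMem_maximalIdeal.mp hc
      rw [Ideal.ofList_cons, Ideal.ofList_cons]
      refine le_antisymm (sup_le ?_ le_sup_right) (sup_le ?_ le_sup_right)
      · rw [Ideal.span_singleton_le_iff_mem]
        exact add_mem (Submodule.mem_sup_left hz) (Submodule.mem_sup_right hy)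
      · rw [Ideal.span_singleton_le_iff_mem, ← Ideal.unit_mul_mem_iff_mem _ hcu]
        have h1 : c * x + y ∈ Ideal.span {c * x + y} ⊔ Ideal.ofList u :=
          Submodule.mem_sup_left (Ideal.mem_span_singleton_self _)
        simpa using sub_mem h1 (Submodule.mem_sup_right hy)

/-- A regular sequence of length `d + 1` in a local ring can be exchanged for one starting with
an element that is also superficial for a given primary ideal `I`, and part of a minimal
generating set of `I`. -/
theorem exists_superficial_regular {R : Type*} [CommRing R] [IsNoetherianRing R] [IsLocalRing R]
    [Infinite (IsLocalRing.ResidueField R)] {ps : List R} {x : R}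
    (hmem : ∀ y ∈ ps ++ [x], y ∈ maximalIdeal R)
    (hreg : RingTheory.Sequence.IsWeaklyRegular R (ps ++ [x])) {I : Ideal R}
    (hIm : I ≤ maximalIdeal R) (hmI : maximalIdeal R ≤ I.radical) :
    ∃ a ∈ I, a ∉ maximalIdeal R * I ∧
      RingTheory.Sequence.IsWeaklyRegular R (a :: ps) ∧
      ∃ n₀, ∀ n ≥ n₀, ∀ r, r ∈ I ^ n ↔ r * a ∈ I ^ (n + 1) := by
  classical
  have hIfg : I.FG := IsNoetherian.noetherian I
  rw [RingTheory.Sequence.isWeaklyRegular_append_iff,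
    RingTheory.Sequence.isWeaklyRegular_singleton_iff] at hreg
  obtain ⟨hps, hx⟩ := hreg
  set M := R ⧸ (Ideal.ofList ps • ⊤ : Submodule R R)
  have hM : Nontrivial M := by
    refine Submodule.Quotient.nontrivial_iff.mpr fun h ↦ ?_
    have h1 : Ideal.ofList ps ≤ maximalIdeal R :=
      Ideal.span_le.mpr fun y hy ↦ hmem y (List.mem_append_left _ hy)
    have h2 : (1 : R) ∈ Ideal.ofList ps • (⊤ : Submodule R R) := by
      rw [h]
      exact Submodule.mem_top
    exact (Ideal.ne_top_iff_one _).mp (maximalIdeal.isMaximal R).ne_top (h1 (by simpa using h2))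
  have hass : ∀ P ∈ associatedPrimes R M, ¬ I ≤ P := by
    intro P hP hIP
    have hxP : x ∈ P := hP.isPrime.radical_le_iff.mpr hIP (hmI (hmem x (by simp)))
    have hz : x ∈ ⋃ p ∈ associatedPrimes R M, (p : Set R) := Set.mem_biUnion hP hxP
    rw [biUnion_associatedPrimes_eq_zero_divisors] at hz
    obtain ⟨y, hy, hxy⟩ := hz
    exact hy (hx.right_eq_zero_of_smul hxy)
  have hnak : ¬ I ≤ maximalIdeal R * I := by
    intro h
    have hbot : I = ⊥ := Submodule.eq_bot_of_le_smul_of_le_jacobson_bot _ I hIfg h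
      (maximalIdeal_le_jacobson _)
    obtain ⟨P, hP⟩ := associatedPrimes.nonempty R M
    exact hass P hP (hbot ▸ bot_le)
  obtain ⟨s, hs, c, hc⟩ := I.exists_finset_forall_superficial
  obtain ⟨a, ha, has⟩ := Ideal.exists_mem_forall_notMem hIfg
    (insert (maximalIdeal R * I) (s ∪ (associatedPrimes.finite R M).toFinset)) (by
      intro N hN
      simp only [Finset.mem_insert, Finset.mem_union, Set.Finite.mem_toFinset] at hN
      rcases hN with rfl | hN | hN
      exacts [hnak, hs N hN, hass N hN])
  simp only [Finset.mem_insert, Finset.mem_union, Set.Finite.mem_toFinset] at has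
  have haM : IsSMulRegular M a := by
    refine isSMulRegular_iff_right_eq_zero_of_smul.mpr fun y hay ↦ ?_
    by_contra hy
    have hz : a ∈ {r : R | ∃ x : M, x ≠ 0 ∧ r • x = 0} := ⟨y, hy, hay⟩
    rw [← biUnion_associatedPrimes_eq_zero_divisors] at hz
    obtain ⟨P, hP, haP⟩ := Set.mem_iUnion₂.mp hz
    exact has P (Or.inr (Or.inr hP)) haP
  have hreg : RingTheory.Sequence.IsWeaklyRegular R (ps ++ [a]) :=
    (RingTheory.Sequence.isWeaklyRegular_append_iff _ _ _).mpr
      ⟨hps, (RingTheory.Sequence.isWeaklyRegular_singleton_iff _ _).mpr haM⟩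
  have hreg' : RingTheory.Sequence.IsWeaklyRegular R (a :: ps) :=
    IsLocalRing.isWeaklyRegular_of_perm_of_subset_maximalIdeal hreg
      (List.perm_append_singleton a ps) fun y hy ↦ by
        rcases List.mem_append.mp hy with hy | hy
        · exact hmem y (List.mem_append_left _ hy)
        · exact hIm (List.mem_singleton.mp hy ▸ ha)
  exact ⟨a, ha, has _ (Or.inl rfl), hreg', Ideal.mul_mem_pow_succ_iff_of_superficial ha
    ((RingTheory.Sequence.isWeaklyRegular_cons_iff _ _ _).mp hreg').1
    (hc a ha fun N hN ↦ has N (Or.inr (Or.inl hN)))⟩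

theorem RingTheory.Sequence.IsWeaklyRegular.map_quotientMk {R : Type*} [CommRing R] {a : R}
    {ps : List R} (h : IsWeaklyRegular R (a :: ps)) :
    IsWeaklyRegular (R ⧸ Ideal.span {a}) (ps.map (Ideal.Quotient.mk (Ideal.span {a}))) := by
  refine (isWeaklyRegular_map_algebraMap_iff (R ⧸ Ideal.span {a}) _ ps).mpr ?_
  have h2 := ((isWeaklyRegular_cons_iff _ _ _).mp h).2
  refine (LinearEquiv.isWeaklyRegular_congr (Submodule.quotEquivOfEq _ _ ?_) ps).mp h2
  rw [← Submodule.ideal_span_singleton_smul]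
  simp

theorem IsLocalRing.infinite_residueField_of_surjective {R S : Type*} [CommRing R] [CommRing S]
    [IsLocalRing R] [IsLocalRing S] [Infinite (IsLocalRing.ResidueField R)] {f : R →+* S}
    (hf : Function.Surjective f) : Infinite (IsLocalRing.ResidueField S) := by
  have := hf.isLocalHom
  exact Infinite.of_injective _ (IsLocalRing.ResidueField.map f).injective

/-- Over a local ring with infinite residue field and depth at least `d`, a primary ideal `I`
with Hilbert coefficients `e` in dimension `d` has `d` minimal generators that generate an ideal
of colength `e 0`. -/
theorem exists_parameters_colength_eq (d : ℕ) {R : Type*} [CommRing R] [IsNoetherianRing R]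
    [IsLocalRing R] [Infinite (IsLocalRing.ResidueField R)] {rs : List R} (hlen : rs.length = d)
    (hmem : ∀ x ∈ rs, x ∈ maximalIdeal R) (hreg : RingTheory.Sequence.IsWeaklyRegular R rs)
    {I : Ideal R} (hIm : I ≤ maximalIdeal R) (hmI : maximalIdeal R ≤ I.radical) {e : ℕ → ℤ}
    (he : HasHilbertCoeffs I d e) {u : List R} (hu : Ideal.ofList u = I) :
    ∃ s t : List R, s.length = d ∧ s.length + t.length ≤ u.length ∧
      Ideal.ofList s ⊔ Ideal.ofList t = I ∧
      ∃ l : ℕ, (Ideal.ofList s).colength = l ∧ (l : ℤ) = e 0 := by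
  induction d generalizing R with
  | zero =>
    refine ⟨[], u, rfl, by simp, by simpa using hu, ?_⟩
    obtain ⟨N, hN⟩ := hasHilbertCoeffs_iff.mp he
    obtain ⟨l, h, hl⟩ := hN N le_rfl
    obtain ⟨l', h', hl'⟩ := hN (N + 1) (by omega)
    have hll : l = l' := by
      simp only [zero_add, Finset.sum_range_one] at hl hl'
      simp only [Nat.sub_zero, Nat.choose_zero_right] at hl hl'
      omega
    obtain ⟨t, ht, hpow⟩ := Ideal.exists_sup_ofList_eq (I := I ^ (N + 1)) (by simp [h]) 0
      (J := I ^ (N + 1 + 1)) (Ideal.pow_le_pow_right (by omega)) (by rw [h, h', hll]; simp)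
    rw [List.length_eq_zero_iff.mp (Nat.le_zero.mp ht), Ideal.ofList_nil, sup_bot_eq,
      pow_succ' _ (N + 1)] at hpow
    have hbot : I ^ (N + 1) = ⊥ := Submodule.eq_bot_of_le_smul_of_le_jacobson_bot I _
      (IsNoetherian.noetherian _) hpow.ge (hIm.trans (maximalIdeal_le_jacobson _))
    refine ⟨l, by rw [Ideal.ofList_nil, ← hbot, h], ?_⟩
    simpa using hl
  | succ d ih =>
    obtain ⟨ps, x, rfl⟩ : ∃ ps x, rs = ps ++ [x] :=
      (List.eq_nil_or_concat' rs).resolve_left fun h ↦ by simp [h] at hlen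
    obtain ⟨a, ha, hamI, hareg, n₀, hn₀⟩ := exists_superficial_regular hmem hreg hIm hmI
    obtain ⟨v, hv, hav⟩ := Ideal.exists_ofList_cons_eq u (hu ▸ ha) (hu ▸ hamI)
    rw [hu, Ideal.ofList_cons] at hav
    set f := Ideal.Quotient.mk (Ideal.span {a})
    have hf : Function.Surjective f := Ideal.Quotient.mk_surjective
    have : Nontrivial (R ⧸ Ideal.span {a}) := Ideal.Quotient.nontrivial_iff.mpr fun h ↦
      (maximalIdeal.isMaximal R).ne_top (top_le_iff.mp
        (h ▸ (Ideal.span_singleton_le_iff_mem _).mpr (hIm ha)))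
    have : IsLocalRing (R ⧸ Ideal.span {a}) := IsLocalRing.of_surjective' f hf
    have : Infinite (IsLocalRing.ResidueField (R ⧸ Ideal.span {a})) :=
      IsLocalRing.infinite_residueField_of_surjective hf
    have hmap := IsLocalRing.map_maximalIdeal_of_surjective f hf
    have hcomap : ∀ A : Ideal R, (A.map f).comap f = Ideal.span {a} ⊔ A := fun A ↦ by
      rw [Ideal.comap_map_of_surjective' f hf, Ideal.mk_ker, sup_comm]
    obtain ⟨s, t, hs, hst, hgen, l, hl, hle⟩ := ih (rs := ps.map f) (by simpa using hlen)
      (by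
        intro y hy
        obtain ⟨z, hz, rfl⟩ := List.mem_map.mp hy
        exact hmap ▸ Ideal.mem_map_of_mem f (hmem z (List.mem_append_left _ hz)))
      hareg.map_quotientMk (I := I.map f) (hmap ▸ Ideal.map_mono hIm)
      (by
        rw [← hmap]
        exact (Ideal.map_mono hmI).trans (Ideal.map_radical_le f))
      (he.map_quotientMk hn₀) (u := v.map f) (by
        rw [← Ideal.map_ofList, ← hav, Ideal.map_sup, Ideal.map_quotient_self, bot_sup_eq])
    obtain ⟨s, rfl⟩ := hf.list_map s
    obtain ⟨t, rfl⟩ := hf.list_map t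
    simp only [List.length_map, ← Ideal.map_ofList, ← Ideal.map_sup] at hs hst hgen hl
    refine ⟨a :: s, t, by simp [hs], by simp; omega, ?_, l, ?_, hle⟩
    · have h := congrArg (Ideal.comap f) hgen
      rw [hcomap, hcomap, sup_eq_right.mpr ((Ideal.span_singleton_le_iff_mem I).mpr ha)] at h
      rw [Ideal.ofList_cons, sup_assoc, h]
    · rw [Ideal.ofList_cons, ← Ideal.colength_map_quotientMk, hl]

end Parameters

section Bounds

variable {R : Type*} [CommRing R]

theorem Ideal.colength_ofList_pow_le (s : List R) (n : ℕ) :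
    (Ideal.ofList s ^ n).colength ≤
      ∑ j ∈ Finset.range n, (Nat.multichoose s.length j : ℕ∞) * (Ideal.ofList s).colength := by
  induction n with
  | zero => simp [Ideal.colength, Ideal.one_eq_top]
  | succ n ih =>
    obtain ⟨u, hu, hus⟩ := Ideal.exists_ofList_eq_pow s n
    have h := Ideal.colength_le_add_length_mul (B := Ideal.ofList s ^ (n + 1))
      (Q := Ideal.ofList s) u fun x hx q hq ↦ by
        rw [pow_succ', ← hus]
        exact Ideal.mul_mem_mul hq (Ideal.subset_span hx)
    rw [hus, sup_eq_right.mpr (Ideal.pow_le_pow_right n.le_succ), hu] at h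
    rw [Finset.sum_range_succ]
    exact h.trans (by gcongr)

theorem Ideal.colength_mul_ofList_le (Q : Ideal R) (xs : List R) :
    (Q * Ideal.ofList xs).colength ≤ (Ideal.ofList xs).colength + xs.length * Q.colength := by
  have h := Ideal.colength_le_add_length_mul (B := Q * Ideal.ofList xs) (Q := Q) xs
    fun x hx q hq ↦ Ideal.mul_mem_mul hq (Ideal.subset_span hx)
  rwa [sup_eq_right.mpr Ideal.mul_le_right] at h

theorem IsLocalRing.colength_maximalIdeal [IsLocalRing R] :
    (maximalIdeal R).colength = 1 := by
  have : IsSimpleModule R (R ⧸ maximalIdeal R) :=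
    isSimpleModule_iff_isCoatom.mpr (maximalIdeal.isMaximal R).out
  exact Module.length_eq_one R _

/-- For `J = (s) ⊆ I = (s, t)`, the ideal `m Iⁿ⁺¹` has colength bounded in terms of the colengths
of `I` and `J`. -/
theorem Ideal.colength_maximalIdeal_mul_pow_succ_le [IsLocalRing R] {I : Ideal R} {s t : List R}
    (hst : Ideal.ofList s ⊔ Ideal.ofList t = I) (n : ℕ) :
    (maximalIdeal R * I ^ (n + 1)).colength ≤
      ∑ j ∈ Finset.range n, (Nat.multichoose s.length j : ℕ∞) * (Ideal.ofList s).colength +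
        Nat.multichoose s.length n * I.colength +
        (Nat.multichoose s.length (n + 1) + t.length * Nat.multichoose s.length n) := by
  obtain ⟨u, hu, hus⟩ := Ideal.exists_ofList_eq_pow s n
  obtain ⟨u', hu', hus'⟩ := Ideal.exists_ofList_eq_pow s (n + 1)
  obtain ⟨v, hv, hvs⟩ := Ideal.exists_ofList_eq_mul t u
  have hJI : Ideal.ofList s ≤ I := hst ▸ le_sup_left
  have hgen : Ideal.ofList (u' ++ v) = I * Ideal.ofList s ^ n := by
    rw [Ideal.ofList_append, hus', hvs, hus, pow_succ', ← Ideal.sup_mul, hst]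
  have h1 := Ideal.colength_mul_ofList_le (maximalIdeal R) (u' ++ v)
  have h2 := Ideal.colength_mul_ofList_le I u
  have h3 := Ideal.colength_ofList_pow_le s n
  rw [hgen, IsLocalRing.colength_maximalIdeal, mul_one, List.length_append, hu', hv, hu] at h1
  rw [hus, hu] at h2
  have h0 : maximalIdeal R * (I * Ideal.ofList s ^ n) ≤ maximalIdeal R * I ^ (n + 1) := by
    rw [pow_succ']
    exact Ideal.mul_mono_right (Ideal.mul_mono_right (Ideal.pow_right_mono hJI n))
  refine (Ideal.colength_anti h0).trans (h1.trans ?_)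
  push_cast
  gcongr
  exact h2.trans (by gcongr)

end Bounds

section Asymptotics

open Filter Topology

theorem tendsto_choose_add_div_pow (a : ℕ) {b k : ℕ} (hbk : b ≤ k) :
    Tendsto (fun n : ℕ ↦ ((n + a).choose b : ℝ) / (n : ℝ) ^ k) atTop
      (𝓝 (if b = k then (k.factorial : ℝ)⁻¹ else 0)) := by
  have hadd : Tendsto (fun n : ℕ ↦ ((n + a : ℕ) : ℝ) / n) atTop (𝓝 1) := by
    have h := (tendsto_const_div_atTop_nhds_zero_nat (a : ℝ)).const_add 1
    rw [add_zero] at h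
    refine h.congr' ?_
    filter_upwards [eventually_ne_atTop 0] with n hn
    push_cast
    field_simp
  have hch : Tendsto (fun n : ℕ ↦ ((n + a).choose b : ℝ) / (n : ℝ) ^ b) atTop
      (𝓝 (b.factorial : ℝ)⁻¹) := by
    have hne : ∀ᶠ n : ℕ in atTop, (n : ℝ) ^ b / (b.factorial : ℝ) ≠ 0 := by
      filter_upwards [eventually_ne_atTop 0] with n hn
      positivity
    have h1 := (((Asymptotics.isEquivalent_iff_tendsto_one hne).mp
      (isEquivalent_choose b)).comp (tendsto_add_atTop_nat a)).mul
        ((hadd.pow b).mul_const (b.factorial : ℝ)⁻¹)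
    rw [one_pow, one_mul, one_mul] at h1
    refine h1.congr' ?_
    filter_upwards [eventually_ne_atTop 0] with n hn
    have : ((n + a : ℕ) : ℝ) ≠ 0 := by positivity
    simp only [Function.comp_apply, Pi.div_apply, div_pow]
    field_simp
  split_ifs with h
  · exact h ▸ hch
  · obtain ⟨c, rfl⟩ := Nat.exists_eq_add_of_lt (lt_of_le_of_ne hbk h)
    have h0 : Tendsto (fun n : ℕ ↦ ((n : ℝ) ^ (c + 1))⁻¹) atTop (𝓝 0) :=
      ((tendsto_pow_atTop c.succ_ne_zero).comp tendsto_natCast_atTop_atTop).inv_tendsto_atTop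
    have h1 := hch.mul h0
    rw [mul_zero] at h1
    refine h1.congr fun n ↦ ?_
    rw [add_assoc, pow_add _ b, ← div_div, div_eq_mul_inv (_ / _)]

theorem tendsto_sum_choose_div_pow (p k : ℕ) (a : ℕ → ℤ) :
    Tendsto (fun n : ℕ ↦
      ((∑ i ∈ Finset.range (k + 1), a i * ((n + p + k - i).choose (k - i)) : ℤ) : ℝ) /
        (n : ℝ) ^ k) atTop (𝓝 (a 0 * (k.factorial : ℝ)⁻¹)) := by
  have h : Tendsto (fun n : ℕ ↦ ∑ i ∈ Finset.range (k + 1),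
      (a i : ℝ) * (((n + (p + (k - i))).choose (k - i) : ℝ) / (n : ℝ) ^ k)) atTop
      (𝓝 (∑ i ∈ Finset.range (k + 1),
        (a i : ℝ) * if k - i = k then (k.factorial : ℝ)⁻¹ else 0)) :=
    tendsto_finsetSum _ fun i _ ↦
      (tendsto_choose_add_div_pow _ (Nat.sub_le k i)).const_mul _
  rw [Finset.sum_eq_single_of_mem 0 (by simp) fun i hi hi0 ↦ by
    rw [if_neg (by rw [Finset.mem_range] at hi; omega), mul_zero]] at h
  simp only [Nat.sub_zero, if_true] at h
  refine h.congr fun n ↦ ?_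
  push_cast
  rw [Finset.sum_div]
  refine Finset.sum_congr rfl fun i hi ↦ ?_
  rw [Finset.mem_range] at hi
  rw [mul_div_assoc, show n + (p + (k - i)) = n + p + k - i by omega]

/-- The leading coefficient of a numerical polynomial whose shift is eventually bounded by
`A C(n+k,k) + C(n+1+k,k) + ∑ b i C(n+k-i,k-i)` is at most `A + 1 + b 0`. -/
theorem leadingCoeff_le_of_forall_ge {k N : ℕ} {c b : ℕ → ℤ} {A : ℤ}
    (h : ∀ n ≥ N, ∑ i ∈ Finset.range (k + 1), c i * ((n + 1 + k - i).choose (k - i)) ≤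
      A * ((n + k).choose k) + ((n + 1 + k).choose k) +
        ∑ i ∈ Finset.range (k + 1), b i * ((n + k - i).choose (k - i))) :
    c 0 ≤ A + 1 + b 0 := by
  have hA : ∀ p, Tendsto (fun n : ℕ ↦ ((n + (p + k)).choose k : ℝ) / (n : ℝ) ^ k) atTop
      (𝓝 (k.factorial : ℝ)⁻¹) := fun p ↦ by
    simpa using tendsto_choose_add_div_pow (p + k) (le_refl k)
  have hlim := le_of_tendsto_of_tendsto (tendsto_sum_choose_div_pow 1 k c)
    ((((hA 0).const_mul (A : ℝ)).add (hA 1)).add (tendsto_sum_choose_div_pow 0 k b)) (by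
      filter_upwards [eventually_ge_atTop N] with n hn
      have hn' : ((_ : ℤ) : ℝ) ≤ ((_ : ℤ) : ℝ) := Int.cast_le.mpr (h n hn)
      rw [Int.cast_add, Int.cast_add, Int.cast_mul, Int.cast_natCast, Int.cast_natCast] at hn'
      have := div_le_div_of_nonneg_right hn' (by positivity : 0 ≤ (n : ℝ) ^ k)
      simpa only [add_div, mul_div_assoc, add_zero, zero_add, add_assoc] using this)
  rw [← add_one_mul, ← add_mul, mul_le_mul_iff_left₀ (by positivity)] at hlim
  exact_mod_cast hlim

end Asymptotics

section FiberMultiplicity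

theorem Nat.multichoose_succ_eq_choose (k n : ℕ) :
    (k + 1).multichoose n = (n + k).choose k := by
  rw [Nat.multichoose_eq, Nat.choose_symm_of_eq_add (a := n) (b := k) (by omega),
    show k + 1 + n - 1 = n + k by omega]

theorem Nat.sum_range_choose_add (k n : ℕ) :
    ∑ j ∈ Finset.range n, (j + k).choose k = (n + k).choose (k + 1) := by
  induction n with
  | zero => simp
  | succ n ih => rw [Finset.sum_range_succ, ih, show n + 1 + k = n + k + 1 by omega,
      Nat.choose_succ_succ', add_comm]

variable {R : Type*} [CommRing R]

theorem HasFiberMultiplicity.le_of_ofList_sup_eq [IsLocalRing R] {k : ℕ} {I : Ideal R} {e : ℕ → ℤ}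
    (he : HasHilbertCoeffs I (k + 1) e) {f0 : ℤ} (hf0 : HasFiberMultiplicity I (k + 1) f0)
    {s t : List R} (hs : s.length = k + 1) (hst : Ideal.ofList s ⊔ Ideal.ofList t = I)
    {l lI : ℕ} (hl : (Ideal.ofList s).colength = l) (hle : (l : ℤ) = e 0)
    (hlI : I.colength = lI) :
    f0 ≤ e 1 - e 0 + lI + t.length + 1 := by
  obtain ⟨c, N, rfl, hc⟩ := hf0
  obtain ⟨N', hN'⟩ := hasHilbertCoeffs_iff.mp he
  refine (leadingCoeff_le_of_forall_ge (N := N + N') (k := k) (c := c)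
    (b := fun i ↦ (-1) ^ i * e (i + 1)) (A := lI + t.length - e 0) fun n hn ↦ ?_).trans
      (by simp only [pow_zero, one_mul, zero_add]; omega)
  obtain ⟨p, hp, hpc⟩ := hc (n + 1) (by omega)
  obtain ⟨q, hq, hqe⟩ := hN' n (by omega)
  rw [moduleLength_eq_coe_iff] at hp
  have h := Ideal.colength_maximalIdeal_mul_pow_succ_le hst n
  rw [Ideal.colength_eq_length_add Ideal.mul_le_right, hp, hq, hl, hlI, hs,
    ← Finset.sum_mul] at h
  simp only [Nat.multichoose_succ_eq_choose] at h
  norm_cast at h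
  rw [Nat.sum_range_choose_add] at h
  rw [Finset.sum_range_succ'] at hqe
  simp only [Nat.add_sub_add_right, Nat.sub_zero, pow_zero, one_mul, pow_succ, mul_neg_one,
    neg_mul, Finset.sum_neg_distrib, ← Nat.add_assoc] at hqe
  simp only [Nat.add_sub_cancel] at hpc
  rw [← hpc]
  zify at h
  rw [hle, hqe, Nat.choose_succ_succ'] at h
  push_cast at h ⊢
  linarith

theorem le_add_colength_sub [IsLocalRing R] {I : Ideal R} {s : List R}
    (hsI : Ideal.ofList s ≤ I) {l lI : ℕ} (hl : (Ideal.ofList s).colength = l)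
    (hlI : I.colength = lI) {ν : ℕ}
    (hν : ν ∈ lowerBounds {n : ℕ | ∃ s : Finset R, s.card = n ∧ Ideal.span (s : Set R) = I}) :
    lI + ν ≤ s.length + l := by
  classical
  have hle : lI ≤ l := by
    have := Ideal.colength_anti hsI
    rw [hl, hlI] at this
    exact_mod_cast this
  obtain ⟨t, ht, hst⟩ := Ideal.exists_sup_ofList_eq (by simp [hlI]) (l - lI) hsI (by
    rw [hl, hlI]
    exact_mod_cast (Nat.add_sub_cancel' hle).ge)
  have h1 : ν ≤ (s ++ t).toFinset.card := hν ⟨_, rfl, by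
    rw [List.coe_toFinset, ← hst, ← Ideal.ofList_append]⟩
  have h2 := (s ++ t).toFinset_card_le
  rw [List.length_append] at h2
  omega

end FiberMultiplicity

/-- **Corso–Polini–Vasconcelos (2006), Theorem 2.1 / Proposition 2.2**.  Let `(R,m)` be a
Cohen-Macaulay Noetherian local ring of dimension `d > 0` with infinite residue field and
`I` an `m`-primary ideal.  Then
`f₀(I) ≤ e₁(I) - e₀(I) + λ(R/I) + ν(I) - d + 1 ≤ e₁(I) + 1`. -/
theorem fiber_multiplicity_bound
    {R : Type*} [CommRing R] [IsNoetherianRing R] [IsLocalRing R]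
    (d : ℕ) (hd : 0 < d) (hdim : ringKrullDim R = d)
    (hCM : IsCohenMacaulayLocalRing R)
    (hres : Infinite (IsLocalRing.ResidueField R))
    (I : Ideal R) (hI : I.radical = maximalIdeal R)
    (e : ℕ → ℤ) (he : HasHilbertCoeffs I d e)
    (f0 : ℤ) (hf0 : HasFiberMultiplicity I d f0)
    (lI : ℕ) (hlI : moduleLength R (R ⧸ I) = (lI : WithBot ℕ∞))
    (ν : ℕ) (hν : IsLeast {n : ℕ | ∃ s : Finset R, s.card = n ∧ Ideal.span (s : Set R) = I} ν) :
    f0 ≤ e 1 - e 0 + (lI : ℤ) + (ν : ℤ) - (d : ℤ) + 1 ∧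
      e 1 - e 0 + (lI : ℤ) + (ν : ℤ) - (d : ℤ) + 1 ≤ e 1 + 1 := by
  obtain ⟨rs, hmem, hreg, hlen⟩ := hCM
  have hlen : rs.length = d := by
    rw [hdim] at hlen
    exact_mod_cast hlen
  obtain ⟨k, rfl⟩ := Nat.exists_eq_add_one_of_ne_zero hd.ne'
  obtain ⟨u, rfl, hu⟩ := hν.1
  rw [moduleLength_eq_coe_iff] at hlI
  obtain ⟨s, t, hs, hcard, hst, l, hl, hle⟩ := exists_parameters_colength_eq (k + 1) hlen hmem
    hreg.toIsWeaklyRegular (Ideal.le_radical.trans hI.le) hI.ge he (u := u.toList)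
    (by rw [← hu]; simp [Ideal.ofList])
  have h1 := hf0.le_of_ofList_sup_eq he hs hst hl hle hlI
  have h2 := le_add_colength_sub (hst ▸ le_sup_left) hl hlI hν.2
  rw [Finset.length_toList] at hcard
  omega
end
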